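/- arXiv:2306.12148 — 12 statements merged into one kernel-verified Lean document; each statement's English description precedes it below -/
import Mathlib

section
/- Let R be a subring of the complex numbers all of whose elements are algebraic over ℚ, and suppose that the group of units R^× is finite. Then R = ℤ, or there exists a squarefree integer d < 0 such that R is an order in the imaginary quadratic field ℚ(√d). -/
/-- `ℚ(√d)`: the subfield of `ℂ` generated (over `ℚ`, which is contained in every
subfield of `ℂ`) by the square roots of `d`. -/
noncomputable def Qsqrt (d : ℤ) : Subfield ℂ := Subfield.closure {z : ℂ | z ^ 2 = (d : ℂ)}

/-- `R` is an order in the subfield `F` of `ℂ`: `R ⊆ F`, `R` is finitely generated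
as a `ℤ`-module (equivalently, as an additive group), and `R` contains a `ℚ`-basis
of `F`, i.e. the `ℚ`-span of `R` is `F`. -/
noncomputable def IsOrderIn (R : Subring ℂ) (F : Subfield ℂ) : Prop :=
  (R : Set ℂ) ⊆ (F : Set ℂ) ∧ R.toAddSubgroup.FG ∧
    (Submodule.span ℚ (R : Set ℂ) : Set ℂ) = (F : Set ℂ)

open NumberField

/-- Every element of the fraction field of a Dedekind domain with finite class group has a positive
power which is a fraction with coprime numerator and denominator. -/
theorem IsDedekindDomain.exists_pow_eq_coprime_fraction (A : Type*) {K : Type*} [CommRing A]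
    [IsDedekindDomain A] [Finite (ClassGroup A)] [Field K] [Algebra A K] [IsFractionRing A K]
    (x : K) : ∃ k : ℕ, 0 < k ∧ ∃ a b : A, b ≠ 0 ∧ IsCoprime a b ∧
      algebraMap A K b * x ^ k = algebraMap A K a := by
  obtain ⟨n, m, hm, rfl⟩ := IsFractionRing.div_surjective (A := A) x
  have hm0 : m ≠ 0 := nonZeroDivisors.ne_zero hm
  set I : Ideal A := Ideal.span {n} ⊔ Ideal.span {m} with hI
  have hI0 : I ≠ 0 := by
    intro h
    have : m ∈ I := Ideal.mem_sup_right (Ideal.mem_span_singleton_self m)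
    rw [h] at this
    exact hm0 (by simpa using this)
  have hImem : I ∈ nonZeroDivisors (Ideal A) := mem_nonZeroDivisors_of_ne_zero hI0
  obtain ⟨N, hN⟩ : I ∣ Ideal.span {n} := Ideal.dvd_iff_le.2 le_sup_left
  obtain ⟨M, hM⟩ : I ∣ Ideal.span {m} := Ideal.dvd_iff_le.2 le_sup_right
  have hNM : N ⊔ M = ⊤ := by
    refine mul_left_cancel₀ hI0 ?_
    rw [Ideal.mul_sup, ← hN, ← hM, ← hI, Ideal.mul_top]
  set k := Nat.card (ClassGroup A)
  have hpow : I ^ k = Ideal.span {n ^ k} ⊔ Ideal.span {m ^ k} := by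
    rw [← Ideal.span_singleton_pow, ← Ideal.span_singleton_pow, hN, hM, mul_pow, mul_pow,
      ← Ideal.mul_sup, Ideal.pow_sup_pow_eq_top hNM, Ideal.mul_top]
  have hprin : (I ^ k).IsPrincipal := by
    rw [← ClassGroup.mk0_eq_one_iff (pow_mem hImem k)]
    have : (⟨I ^ k, pow_mem hImem k⟩ : nonZeroDivisors (Ideal A)) = ⟨I, hImem⟩ ^ k := rfl
    rw [this, map_pow, pow_card_eq_one']
  obtain ⟨g, hg⟩ := hprin
  rw [hpow, Ideal.submodule_span_eq] at hg
  have h1 : n ^ k ∈ Ideal.span {g} := hg ▸ Ideal.mem_sup_left (Ideal.mem_span_singleton_self _)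
  have h2 : m ^ k ∈ Ideal.span {g} := hg ▸ Ideal.mem_sup_right (Ideal.mem_span_singleton_self _)
  obtain ⟨a, ha⟩ := Ideal.mem_span_singleton'.1 h1
  obtain ⟨b, hb⟩ := Ideal.mem_span_singleton'.1 h2
  have hmk : m ^ k ≠ 0 := pow_ne_zero _ hm0
  have hg0 : g ≠ 0 := by rintro rfl; exact hmk (by simpa using hb.symm)
  have hb0 : b ≠ 0 := by rintro rfl; exact hmk (by simpa using hb.symm)
  refine ⟨k, Nat.card_pos, a, b, hb0, ?_, ?_⟩
  · have h3 : g ∈ Ideal.span {n ^ k} ⊔ Ideal.span {m ^ k} :=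
      hg ▸ Ideal.mem_span_singleton_self g
    rw [← Ideal.span_insert, Ideal.mem_span_pair] at h3
    obtain ⟨α, β, h⟩ := h3
    refine ⟨α, β, mul_right_cancel₀ hg0 ?_⟩
    rw [← ha, ← hb] at h
    linear_combination h
  · have hmK : algebraMap A K m ≠ 0 := by
      simpa using hm0
    have hgK : algebraMap A K g ≠ 0 := by
      simpa using hg0
    have haK := congrArg (algebraMap A K) ha
    have hbK := congrArg (algebraMap A K) hb
    simp only [map_mul, map_pow] at haK hbK
    rw [div_pow, ← haK, ← hbK]
    have : algebraMap A K b ≠ 0 := by simpa using hb0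
    field_simp

section

variable {K : Type*} [Field K] [NumberField K] {R : Subring K}

theorem exists_nat_mul_integer_mem (hR : ∀ z : K, ∃ n : ℕ, n ≠ 0 ∧ (n : K) * z ∈ R) :
    ∃ f : ℕ, f ≠ 0 ∧ ∀ z : 𝓞 K, (f : K) * z ∈ R := by
  classical
  choose n hn hnR using hR
  obtain ⟨S, hS⟩ := Module.finite_def.1 (inferInstance : Module.Finite ℤ (𝓞 K))
  refine ⟨∏ s ∈ S, n s, Finset.prod_ne_zero_iff.2 fun s _ => hn s, fun z => ?_⟩
  have hz : z ∈ Submodule.span ℤ (S : Set (𝓞 K)) := hS ▸ Submodule.mem_top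
  induction hz using Submodule.span_induction with
  | mem s hs =>
    rw [← Finset.prod_erase_mul S (fun s : 𝓞 K => n s) hs, Nat.cast_mul, mul_assoc]
    exact R.mul_mem (natCast_mem R _) (hnR s)
  | zero => simp
  | add x y _ _ hx hy =>
    rw [RingOfIntegers.coe_eq_algebraMap, map_add, mul_add]
    exact R.add_mem hx hy
  | smul a x _ hx =>
    rw [zsmul_eq_mul, RingOfIntegers.coe_eq_algebraMap, map_mul, map_intCast, mul_left_comm]
    exact R.mul_mem (intCast_mem R a) hx

/-- If `R` has finite unit group and contains a multiple of `𝓞 K`, then an algebraic integer `u` has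
finite order as soon as its inverse `v` preserves the conductor `{z | f z 𝓞 K ⊆ R}`. -/
theorem exists_pow_eq_one_of_mul_eq_one [Finite Rˣ] {f : ℕ} (hf : f ≠ 0)
    (hfR : ∀ z : 𝓞 K, (f : K) * z ∈ R) (u : 𝓞 K) (v : K) (huv : (u : K) * v = 1)
    (hv : ∀ z : K, (∀ o : 𝓞 K, (f : K) * o * z ∈ R) → ∀ o : 𝓞 K, (f : K) * o * (v * z) ∈ R) :
    ∃ j : ℕ, 0 < j ∧ u ^ j = 1 := by
  have hvpow (i : ℕ) : ∀ o : 𝓞 K, (f : K) * o * v ^ i ∈ R := by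
    induction i with
    | zero => simpa using hfR
    | succ i ih => rw [pow_succ']; exact hv _ ih
  have hspan : Ideal.span {(f : 𝓞 K)} ≠ ⊥ := by
    rw [Ne, Ideal.span_singleton_eq_bot]; exact_mod_cast hf
  have := Ideal.finiteQuotientOfFreeOfNeBot _ hspan
  obtain ⟨i, k, hik, heq⟩ : ∃ i k : ℕ, i < k ∧
      Ideal.Quotient.mk (Ideal.span {(f : 𝓞 K)}) (u ^ i) = Ideal.Quotient.mk _ (u ^ k) := by
    obtain ⟨i, k, hik, heq⟩ := Finite.exists_ne_map_eq_of_infinite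
      fun n : ℕ => Ideal.Quotient.mk (Ideal.span {(f : 𝓞 K)}) (u ^ n)
    rcases lt_or_gt_of_ne hik with h | h
    exacts [⟨i, k, h, heq⟩, ⟨k, i, h, heq.symm⟩]
  obtain ⟨j, rfl⟩ := Nat.exists_eq_add_of_lt hik
  set l := j + 1 with hl
  rw [Ideal.Quotient.eq, Ideal.mem_span_singleton] at heq
  obtain ⟨c, hc⟩ := heq
  have hcK : (u : K) ^ i - (u : K) ^ (i + l) = f * c := by
    have := congrArg (algebraMap (𝓞 K) K) hc
    simpa [hl, add_assoc] using this
  have huvi (n : ℕ) : (u : K) ^ n * v ^ n = 1 := by rw [← mul_pow, huv, one_pow]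
  have hul : (u : K) ^ l ∈ R := by
    have : (u : K) ^ l = 1 - f * c * v ^ i := by
      rw [← hcK, pow_add]
      linear_combination (1 - u ^ l : K) * huvi i
    rw [this]
    exact R.sub_mem R.one_mem (hvpow i c)
  have hvl : v ^ l ∈ R := by
    have : v ^ l = 1 + f * c * v ^ (i + l) := by
      rw [← hcK, sub_mul, huvi, pow_add v]
      linear_combination (-v ^ l : K) * huvi i
    rw [this]
    exact R.add_mem R.one_mem (hvpow _ c)
  let w : Rˣ := ⟨⟨_, hul⟩, ⟨_, hvl⟩, Subtype.ext (huvi l),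
    Subtype.ext ((mul_comm _ _).trans (huvi l))⟩
  obtain ⟨n, hn, hw⟩ := isOfFinOrder_iff_pow_eq_one.1 (isOfFinOrder_of_finite w)
  refine ⟨l * n, by positivity, RingOfIntegers.ext ?_⟩
  have := congrArg (fun w : Rˣ => ((w : R) : K)) hw
  simpa [w, pow_mul] using this

theorem isIntegral_of_mem_of_finite_units [Finite Rˣ]
    (hR : ∀ z : K, ∃ n : ℕ, n ≠ 0 ∧ (n : K) * z ∈ R) {x : K} (hx : x ∈ R) : IsIntegral ℤ x := by
  obtain ⟨f, hf, hfR⟩ := exists_nat_mul_integer_mem hR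
  obtain ⟨k, hk, a, b, hb, ⟨α, β, hab⟩, hxk⟩ :=
    IsDedekindDomain.exists_pow_eq_coprime_fraction (𝓞 K) x
  have habK := congrArg (algebraMap (𝓞 K) K) hab
  simp only [map_add, map_mul, map_one] at habK
  obtain ⟨j, hj, hbj⟩ := exists_pow_eq_one_of_mul_eq_one hf hfR b ((α : K) * x ^ k + β)
    (by linear_combination habK + α * hxk) (fun z hz o => by
      have h1 := R.mul_mem (hz (o * α)) (R.pow_mem hx k)
      have h2 := hz (o * β)
      convert R.add_mem h1 h2 using 1
      simp only [map_mul]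
      ring)
  have hbjK : (b : K) ^ (j - 1) * b = 1 := by
    rw [← pow_succ, Nat.sub_add_cancel hj, ← map_pow, hbj, map_one]
  have : x ^ k = ((b ^ (j - 1) * a : 𝓞 K) : K) := by
    rw [RingOfIntegers.coe_eq_algebraMap, map_mul, map_pow, ← hxk, ← mul_assoc, hbjK, one_mul]
  exact IsIntegral.of_pow hk (this ▸ RingOfIntegers.isIntegral_coe _)

theorem card_infinitePlace_eq_one_of_finite_units [Finite Rˣ]
    (hR : ∀ z : K, ∃ n : ℕ, n ≠ 0 ∧ (n : K) * z ∈ R) : Fintype.card (InfinitePlace K) = 1 := by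
  obtain ⟨f, hf, hfR⟩ := exists_nat_mul_integer_mem hR
  have hrank : Units.rank K = 0 := by
    rw [← Units.finrank_eq, Module.finrank_eq_zero_iff]
    intro u
    obtain ⟨j, hj, h⟩ := exists_pow_eq_one_of_mul_eq_one hf hfR (u.toMul : 𝓞 K)
      ((u.toMul⁻¹ : (𝓞 K)ˣ) : 𝓞 K) (by rw [← map_mul]; simp) (fun z hz o => by
        have := hz (o * (u.toMul⁻¹ : (𝓞 K)ˣ))
        simpa only [RingOfIntegers.coe_eq_algebraMap, map_mul, mul_assoc] using this)
    refine ⟨j, by exact_mod_cast hj.ne', ?_⟩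
    apply Additive.toMul.injective
    apply Units.ext
    simpa using h
  have := Fintype.card_pos (α := InfinitePlace K)
  rw [Units.rank] at hrank
  omega

end

theorem exists_nat_mul_mem_of_mem_span {R : Subring ℂ} {z : ℂ}
    (hz : z ∈ Submodule.span ℚ (R : Set ℂ)) : ∃ n : ℕ, n ≠ 0 ∧ (n : ℂ) * z ∈ R := by
  induction hz using Submodule.span_induction with
  | mem x hx => exact ⟨1, one_ne_zero, by simpa using hx⟩
  | zero => exact ⟨1, one_ne_zero, by simp⟩
  | add x y _ _ hx hy =>
    obtain ⟨n, hn, hx⟩ := hx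
    obtain ⟨m, hm, hy⟩ := hy
    refine ⟨n * m, mul_ne_zero hn hm, ?_⟩
    convert R.add_mem (R.mul_mem (natCast_mem R m) hx) (R.mul_mem (natCast_mem R n) hy) using 1
    push_cast
    ring
  | smul q x _ hx =>
    obtain ⟨n, hn, hx⟩ := hx
    refine ⟨q.den * n, mul_ne_zero q.den_ne_zero hn, ?_⟩
    convert R.mul_mem (intCast_mem R q.num) hx using 1
    have hq : (q.den : ℂ) * q = q.num := by exact_mod_cast Rat.den_mul_eq_num q
    rw [Rat.smul_def, ← hq]
    push_cast
    ring

section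

variable {R : Subring ℂ} {K : IntermediateField ℚ ℂ}

theorem exists_nat_mul_mem_comap (hK : (K : Set ℂ) ⊆ Submodule.span ℚ (R : Set ℂ)) (z : K) :
    ∃ n : ℕ, n ≠ 0 ∧ (n : K) * z ∈ R.comap (algebraMap K ℂ) := by
  obtain ⟨n, hn, h⟩ := exists_nat_mul_mem_of_mem_span (hK z.2)
  exact ⟨n, hn, by simpa using h⟩

theorem finite_units_comap [Finite Rˣ] : Finite (R.comap (algebraMap K ℂ))ˣ := by
  let φ : R.comap (algebraMap K ℂ) →+* R :=
    ((algebraMap K ℂ).comp (Subring.subtype _)).codRestrict R fun x => x.2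
  have hφ : Function.Injective φ := fun x y h =>
    Subtype.ext ((algebraMap K ℂ).injective (congrArg (fun z : R => (z : ℂ)) h))
  exact Finite.of_injective _ (Units.map_injective (f := (φ : _ →* R)) hφ)

theorem isIntegral_of_mem_of_subset_span [Finite Rˣ] [FiniteDimensional ℚ K]
    (hK : (K : Set ℂ) ⊆ Submodule.span ℚ (R : Set ℂ)) {x : ℂ} (hxR : x ∈ R) (hxK : x ∈ K) :
    IsIntegral ℤ x := by
  have : NumberField K := {}
  have := finite_units_comap (R := R) (K := K)
  have hx : (⟨x, hxK⟩ : K) ∈ R.comap (algebraMap K ℂ) := hxR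
  exact (isIntegral_of_mem_of_finite_units (exists_nat_mul_mem_comap hK) hx).map
    (K.val.restrictScalars ℤ)

theorem finrank_le_two_of_subset_span [Finite Rˣ] [FiniteDimensional ℚ K]
    (hK : (K : Set ℂ) ⊆ Submodule.span ℚ (R : Set ℂ)) :
    Module.finrank ℚ K ≤ 2 := by
  have : NumberField K := {}
  have := finite_units_comap (R := R) (K := K)
  have h := card_infinitePlace_eq_one_of_finite_units (exists_nat_mul_mem_comap hK)
  rw [InfinitePlace.card_eq_nrRealPlaces_add_nrComplexPlaces] at h
  have := InfinitePlace.card_add_two_mul_card_eq_rank K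
  omega

theorem exists_notMem_real_of_subset_span [Finite Rˣ]
    (hK : (K : Set ℂ) ⊆ Submodule.span ℚ (R : Set ℂ)) (h2 : Module.finrank ℚ K = 2) :
    ∃ z ∈ K, z ∉ Set.range ((↑) : ℝ → ℂ) := by
  by_contra! hreal
  have : FiniteDimensional ℚ K := Module.finite_of_finrank_pos (by omega)
  have : NumberField K := {}
  have := finite_units_comap (R := R) (K := K)
  have h := card_infinitePlace_eq_one_of_finite_units (exists_nat_mul_mem_comap hK)
  rw [InfinitePlace.card_eq_nrRealPlaces_add_nrComplexPlaces] at h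
  have h' := InfinitePlace.card_add_two_mul_card_eq_rank K
  have hφ : ComplexEmbedding.IsReal (algebraMap K ℂ) := by
    ext z
    obtain ⟨r, hr⟩ := hreal z z.2
    change starRingEnd ℂ (z : ℂ) = z
    rw [← hr, Complex.conj_ofReal]
  have : 0 < InfinitePlace.nrRealPlaces K := by
    classical
    exact Fintype.card_pos_iff.2 ⟨⟨_, InfinitePlace.isReal_mk_iff.2 hφ⟩⟩
  omega

theorem fg_toAddSubgroup_of_le_integers [FiniteDimensional ℚ K]
    (hR : ∀ x ∈ R, x ∈ K ∧ IsIntegral ℤ x) : R.toAddSubgroup.FG := by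
  have : NumberField K := {}
  let φ : 𝓞 K →ₗ[ℤ] ℂ :=
    ((algebraMap K ℂ).comp (algebraMap (𝓞 K) K)).toAddMonoidHom.toIntLinearMap
  have hle : R.toAddSubgroup.toIntSubmodule ≤ LinearMap.range φ := by
    intro x hx
    obtain ⟨hxK, hxi⟩ := hR x hx
    have hi : IsIntegral ℤ (⟨x, hxK⟩ : K) :=
      (isIntegral_algHom_iff (K.val.restrictScalars ℤ) K.val.injective).1 hxi
    exact ⟨⟨⟨x, hxK⟩, hi⟩, rfl⟩
  have hfg : (LinearMap.range φ).FG := Module.Finite.iff_fg.1 inferInstance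
  have := hfg.of_le hle
  rwa [Submodule.fg_iff_addSubgroup_fg] at this

end

/-- An element of a quadratic extension of `F` outside `F` generates it. -/
theorem IntermediateField.adjoin_simple_eq_of_finrank_eq_two {F L : Type*} [Field F]
    [Field L] [Algebra F L] {K : IntermediateField F L} (h2 : Module.finrank F K = 2) {x : L}
    (hx : x ∈ K) (hx' : x ∉ Set.range (algebraMap F L)) : IntermediateField.adjoin F {x} = K := by
  have : FiniteDimensional F K := Module.finite_of_finrank_pos (by omega)
  have hle : IntermediateField.adjoin F {x} ≤ K := by simpa using hx
  refine IntermediateField.eq_of_le_of_finrank_le hle ?_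
  have : FiniteDimensional F (IntermediateField.adjoin F {x}) :=
    Module.Finite.of_injective (IntermediateField.inclusion hle).toLinearMap
      (IntermediateField.inclusion hle).injective
  have hpos : 0 < Module.finrank F (IntermediateField.adjoin F {x}) := Module.finrank_pos
  have hne : Module.finrank F (IntermediateField.adjoin F {x}) ≠ 1 := by
    rw [Ne, IntermediateField.finrank_adjoin_simple_eq_one_iff, IntermediateField.mem_bot]
    exact hx'
  omega

theorem exists_sq_eq_rat_of_finrank_eq_two {K : IntermediateField ℚ ℂ}
    (h2 : Module.finrank ℚ K = 2) :
    ∃ y ∈ K, y ∉ Set.range (algebraMap ℚ ℂ) ∧ ∃ q : ℚ, y ^ 2 = q := by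
  have : FiniteDimensional ℚ K := Module.finite_of_finrank_pos (by omega)
  obtain ⟨x, hxK, hx⟩ : ∃ x ∈ K, x ∉ Set.range (algebraMap ℚ ℂ) := by
    by_contra! h
    have : K = ⊥ := le_bot_iff.1 fun x hx => IntermediateField.mem_bot.2 (h x hx)
    rw [this, IntermediateField.finrank_bot] at h2
    omega
  have hgen := IntermediateField.adjoin_simple_eq_of_finrank_eq_two h2 hxK hx
  have hint : IsIntegral ℚ x :=
    (Algebra.IsIntegral.isIntegral (R := ℚ) (⟨x, hxK⟩ : K)).map K.val
  have hdeg : (minpoly ℚ x).natDegree = 2 := by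
    rw [← IntermediateField.adjoin.finrank hint, hgen, h2]
  have hlead : (minpoly ℚ x).coeff 2 = 1 := hdeg ▸ (minpoly.monic hint).coeff_natDegree
  have hroot := minpoly.aeval ℚ x
  rw [Polynomial.aeval_eq_sum_range, hdeg] at hroot
  simp only [Finset.sum_range_succ, Finset.sum_range_zero, hlead, Rat.smul_def] at hroot
  set b := (minpoly ℚ x).coeff 1
  set c := (minpoly ℚ x).coeff 0
  refine ⟨2 * x + b, K.add_mem (K.mul_mem (K.algebraMap_mem 2) hxK) (K.algebraMap_mem b), ?_,
    b ^ 2 - 4 * c, ?_⟩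
  · rintro ⟨r, hr⟩
    refine hx ⟨(r - b) / 2, ?_⟩
    rw [eq_ratCast] at hr ⊢
    push_cast
    rw [hr]
    ring
  · push_cast
    push_cast at hroot
    linear_combination 4 * hroot

theorem exists_sq_eq_squarefree_of_finrank_eq_two {K : IntermediateField ℚ ℂ}
    (h2 : Module.finrank ℚ K = 2) :
    ∃ w ∈ K, w ∉ Set.range (algebraMap ℚ ℂ) ∧ ∃ d : ℤ, Squarefree d ∧ w ^ 2 = d := by
  obtain ⟨y, hyK, hy, q, hyq⟩ := exists_sq_eq_rat_of_finrank_eq_two h2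
  obtain ⟨a, s, hsa, ha⟩ := Nat.sq_mul_squarefree (q.num.natAbs * q.den)
  have hden : (q.den : ℂ) ≠ 0 := by exact_mod_cast q.den_ne_zero
  have hq : (q.den : ℂ) * q = q.num := by exact_mod_cast Rat.den_mul_eq_num q
  have hq0 : q ≠ 0 := by
    rintro rfl
    exact hy ⟨0, by simpa using (pow_eq_zero_iff two_ne_zero).1 (hyq.trans Rat.cast_zero) |>.symm⟩
  have hs : (s : ℂ) ≠ 0 := by
    rintro hs
    rw [Nat.cast_eq_zero.1 hs] at hsa
    simp [hq0] at hsa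
  have hr0 : (q.den / s : ℚ) ≠ 0 :=
    div_ne_zero (by exact_mod_cast hden) (by exact_mod_cast hs)
  have hsa' : (s : ℂ) ^ 2 * (q.num.sign * a) = q.num * q.den := by
    have : (s : ℤ) ^ 2 * (q.num.sign * a) = q.num * q.den := by
      have h := congrArg (Nat.cast : ℕ → ℤ) hsa
      push_cast at h
      have h' := Int.sign_mul_abs q.num
      linear_combination q.num.sign * h + q.den * h'
    exact_mod_cast this
  refine ⟨(q.den / s : ℚ) * y, K.mul_mem (K.algebraMap_mem _) hyK, ?_, q.num.sign * a, ?_, ?_⟩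
  · rintro ⟨r, hr⟩
    refine hy ⟨r / (q.den / s : ℚ), ?_⟩
    have : ((q.den / s : ℚ) : ℂ) ≠ 0 := by exact_mod_cast hr0
    rw [map_div₀, hr, eq_ratCast]
    field_simp
  · rw [← Int.squarefree_natAbs, Int.natAbs_mul, Int.natAbs_sign_of_ne_zero (by simpa using hq0)]
    simpa using ha
  · push_cast
    rw [mul_pow, hyq]
    field_simp
    linear_combination q.den * hq - hsa'

theorem Qsqrt_eq_toSubfield {d : ℤ} {w : ℂ} (hw : w ^ 2 = d) :
    Qsqrt d = (IntermediateField.adjoin ℚ {w}).toSubfield := by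
  apply le_antisymm
  · rw [Qsqrt, Subfield.closure_le]
    intro z hz
    have hwK := IntermediateField.mem_adjoin_simple_self ℚ w
    rcases sq_eq_sq_iff_eq_or_eq_neg.1 (hz.trans hw.symm) with rfl | rfl
    · exact hwK
    · exact neg_mem hwK
  · rw [IntermediateField.adjoin_toSubfield, Subfield.closure_le]
    rintro z (⟨q, rfl⟩ | hz)
    · exact SubfieldClass.ratCast_mem _ q
    · rw [Set.mem_singleton_iff.1 hz]
      exact Subfield.subset_closure hw

theorem exists_Qsqrt_eq_of_finrank_eq_two {K : IntermediateField ℚ ℂ}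
    (h2 : Module.finrank ℚ K = 2) (hreal : ∃ z ∈ K, z ∉ Set.range ((↑) : ℝ → ℂ)) :
    ∃ d : ℤ, d < 0 ∧ Squarefree d ∧ Qsqrt d = K.toSubfield := by
  obtain ⟨w, hwK, hw, d, hd, hwd⟩ := exists_sq_eq_squarefree_of_finrank_eq_two h2
  have hgen := IntermediateField.adjoin_simple_eq_of_finrank_eq_two h2 hwK hw
  refine ⟨d, ?_, hd, by rw [Qsqrt_eq_toSubfield hwd, hgen]⟩
  by_contra! hd0
  obtain ⟨z, hzK, hz⟩ := hreal
  have hwr : w ∈ Set.range ((↑) : ℝ → ℂ) := by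
    have h : ((√(d : ℝ) : ℝ) : ℂ) ^ 2 = d := by
      rw [← Complex.ofReal_pow, Real.sq_sqrt (by exact_mod_cast hd0), Complex.ofReal_intCast]
    rcases sq_eq_sq_iff_eq_or_eq_neg.1 (hwd.trans h.symm) with h | h
    · exact ⟨_, h.symm⟩
    · exact ⟨-√(d : ℝ), by rw [h, Complex.ofReal_neg]⟩
  have hle : K ≤ ((Algebra.ofId ℝ ℂ).restrictScalars ℚ).fieldRange := by
    rw [← hgen, IntermediateField.adjoin_simple_le_iff]
    exact hwr
  exact hz (hle hzK)

theorem adjoin_subset_span {R : Subring ℂ} (halg : ∀ x ∈ R, IsAlgebraic ℚ x) {S : Set ℂ}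
    (hS : S ⊆ R) :
    (IntermediateField.adjoin ℚ S : Set ℂ) ⊆ Submodule.span ℚ (R : Set ℂ) := by
  have h := IntermediateField.adjoin_toSubalgebra_of_isAlgebraic fun x hx => halg x (hS hx)
  intro z hz
  rw [SetLike.mem_coe, ← IntermediateField.mem_toSubalgebra, h, ← Subalgebra.mem_toSubmodule,
    Algebra.adjoin_eq_span] at hz
  exact Submodule.span_mono (Submonoid.closure_le (S := R.toSubmonoid).2 hS) hz

theorem stmt0 (R : Subring ℂ) (halg : ∀ x ∈ R, IsAlgebraic ℚ x)
    (hfin : Finite (↥R)ˣ) :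
    R = (Int.castRingHom ℂ).range ∨
      ∃ d : ℤ, d < 0 ∧ Squarefree d ∧ IsOrderIn R (Qsqrt d) := by
  have hint (x : ℂ) (hx : x ∈ R) : IsIntegral ℤ x := by
    have := IntermediateField.adjoin.finiteDimensional (halg x hx).isIntegral
    exact isIntegral_of_mem_of_subset_span
      (adjoin_subset_span halg (Set.singleton_subset_iff.2 hx)) hx
      (IntermediateField.mem_adjoin_simple_self ℚ x)
  by_cases hrat : ∀ x ∈ R, x ∈ Set.range (algebraMap ℚ ℂ)
  · left
    refine le_antisymm (fun x hx => ?_) ?_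
    · obtain ⟨q, rfl⟩ := hrat x hx
      have hq : IsIntegral ℤ q :=
        (isIntegral_algebraMap_iff (algebraMap ℚ ℂ).injective).1 (hint _ hx)
      obtain ⟨n, rfl⟩ := IsIntegrallyClosed.isIntegral_iff.1 hq
      exact ⟨n, by simp⟩
    · rintro _ ⟨n, rfl⟩
      exact intCast_mem R n
  right
  push Not at hrat
  obtain ⟨x, hxR, hx⟩ := hrat
  let K := IntermediateField.adjoin ℚ {x}
  have hKfin : FiniteDimensional ℚ K :=
    IntermediateField.adjoin.finiteDimensional (halg x hxR).isIntegral
  have hKR : (K : Set ℂ) ⊆ Submodule.span ℚ (R : Set ℂ) :=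
    adjoin_subset_span halg (Set.singleton_subset_iff.2 hxR)
  have hK2 : Module.finrank ℚ K = 2 := by
    have h1 : Module.finrank ℚ K ≠ 1 := by
      rw [Ne, IntermediateField.finrank_adjoin_simple_eq_one_iff, IntermediateField.mem_bot]
      exact hx
    have h2 := finrank_le_two_of_subset_span hKR
    have h3 : 0 < Module.finrank ℚ K := Module.finrank_pos
    omega
  have hRK (y : ℂ) (hy : y ∈ R) : y ∈ K := by
    let L := IntermediateField.adjoin ℚ {x, y}
    have hxy : {x, y} ⊆ (R : Set ℂ) := Set.pair_subset hxR hy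
    have : FiniteDimensional ℚ L :=
      IntermediateField.finiteDimensional_adjoin fun z hz => (halg z (hxy hz)).isIntegral
    have hKL : K ≤ L := IntermediateField.adjoin.mono _ _ _ (by simp)
    have hL2 := finrank_le_two_of_subset_span (adjoin_subset_span halg hxy)
    rw [IntermediateField.eq_of_le_of_finrank_le hKL (hL2.trans hK2.ge)]
    exact IntermediateField.subset_adjoin _ _ (by simp)
  obtain ⟨d, hd, hdsq, hdK⟩ :=
    exists_Qsqrt_eq_of_finrank_eq_two hK2 (exists_notMem_real_of_subset_span hKR hK2)
  refine ⟨d, hd, hdsq, ?_⟩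
  rw [hdK]
  refine ⟨hRK, fg_toAddSubgroup_of_le_integers fun y hy => ⟨hRK y hy, hint y hy⟩, ?_⟩
  refine Set.Subset.antisymm ?_ hKR
  exact Submodule.span_le (p := Subalgebra.toSubmodule K.toSubalgebra).2 hRK
end

section
/- Let R be a subring of the complex numbers all of whose elements are algebraic over ℚ, and suppose that the group of units R^× is finite. Then the field of fractions of R (the subfield of ℂ generated by R) is either ℚ or an imaginary quadratic number field, i.e., a field of degree 2 over ℚ not contained in ℝ. -/
open NumberField

theorem isAlgebraic_of_intCast_mul {x : ℂ} {n : ℤ} (hn : n ≠ 0)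
    (h : IsAlgebraic ℚ ((n : ℂ) * x)) : IsAlgebraic ℚ x := by
  have hn' : (n : ℂ) ≠ 0 := by exact_mod_cast hn
  rw [← inv_mul_cancel_left₀ hn' x]
  exact (isAlgebraic_intCast n).inv.mul h

theorem exists_int_mul_mem_of_mem_subfield_closure (R : Subring ℂ)
    (halg : ∀ x ∈ R, IsAlgebraic ℚ x) {x : ℂ} (hx : x ∈ Subfield.closure (R : Set ℂ)) :
    ∃ n : ℤ, n ≠ 0 ∧ (n : ℂ) * x ∈ R := by
  let A : Subalgebra ℚ ℂ :=
    { carrier := {x | ∃ n : ℤ, n ≠ 0 ∧ (n : ℂ) * x ∈ R}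
      mul_mem' := by
        rintro a b ⟨m, hm, hma⟩ ⟨n, hn, hnb⟩
        refine ⟨m * n, mul_ne_zero hm hn, ?_⟩
        convert R.mul_mem hma hnb using 1
        push_cast
        ring
      add_mem' := by
        rintro a b ⟨m, hm, hma⟩ ⟨n, hn, hnb⟩
        refine ⟨m * n, mul_ne_zero hm hn, ?_⟩
        convert R.add_mem (R.mul_mem (intCast_mem R n) hma) (R.mul_mem (intCast_mem R m) hnb)
          using 1
        push_cast
        ring
      algebraMap_mem' := by
        intro q
        refine ⟨q.den, by exact_mod_cast q.den_ne_zero, ?_⟩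
        convert intCast_mem R q.num using 1
        rw [eq_ratCast]
        exact_mod_cast Rat.den_mul_eq_num q }
  have hAalg : ∀ a ∈ A, IsAlgebraic ℚ a := by
    rintro a ⟨n, hn, hna⟩
    exact isAlgebraic_of_intCast_mul hn (halg _ hna)
  let L : Subfield ℂ :=
    { A.toSubring with
      inv_mem' := fun a ha => A.inv_mem_of_algebraic (x := ⟨a, ha⟩) (hAalg a ha) }
  have hRL : Subfield.closure (R : Set ℂ) ≤ L :=
    Subfield.closure_le.mpr fun a ha => ⟨1, one_ne_zero, by simpa using ha⟩
  exact hRL hx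

/-- If every element of a finitely generated abelian group `M` has a nonzero multiple mapping into
a subgroup, then a single nonzero integer works for all of `M`. -/
theorem exists_uniform_int_smul_mem {M N : Type*} [AddCommGroup M] [AddCommGroup N]
    [Module.Finite ℤ M] (f : M →ₗ[ℤ] N) (H : AddSubgroup N)
    (h : ∀ x, ∃ n : ℤ, n ≠ 0 ∧ n • f x ∈ H) :
    ∃ d : ℤ, d ≠ 0 ∧ ∀ x, d • f x ∈ H := by
  obtain ⟨s, hs⟩ := Module.Finite.fg_top (R := ℤ) (M := M)
  choose n hn hnH using h
  refine ⟨∏ y ∈ s, n y, Finset.prod_ne_zero_iff.mpr fun y _ => hn y, fun x => ?_⟩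
  have hx : x ∈ Submodule.span ℤ (s : Set M) := hs ▸ Submodule.mem_top
  induction hx using Submodule.span_induction with
  | mem y hy =>
    obtain ⟨c, hc⟩ := Finset.dvd_prod_of_mem n (Finset.mem_coe.mp hy)
    rw [hc, mul_comm, mul_smul]
    exact H.zsmul_mem (hnH y) c
  | zero => simp
  | add a b _ _ ha hb => simpa [smul_add] using H.add_mem ha hb
  | smul c a _ ha =>
    rw [map_smul, smul_comm]
    exact H.zsmul_mem ha c

theorem isOfFinOrder_unit_of_finite_units {F : Type*} [Field F] [NumberField F] (φ : F →+* ℂ)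
    (R : Subring ℂ) [Finite Rˣ] (h : ∀ x : F, ∃ n : ℤ, n ≠ 0 ∧ (n : ℂ) * φ x ∈ R)
    (u : (𝓞 F)ˣ) : IsOfFinOrder u := by
  let ψ : 𝓞 F →+* ℂ := φ.comp (algebraMap (𝓞 F) F)
  have hψ : Function.Injective ψ := φ.injective.comp RingOfIntegers.coe_injective
  obtain ⟨d, hd, hdR⟩ := exists_uniform_int_smul_mem ψ.toAddMonoidHom.toIntLinearMap
    R.toAddSubgroup fun x => by simpa [ψ] using h x
  have hI : Ideal.span {(d : 𝓞 F)} ≠ ⊥ := by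
    simpa [Ideal.span_singleton_eq_bot] using hd
  have : Finite (𝓞 F ⧸ Ideal.span {(d : 𝓞 F)}) := Ideal.finiteQuotientOfFreeOfNeBot _ hI
  let π := Units.map (Ideal.Quotient.mk (Ideal.span {(d : 𝓞 F)})).toMonoidHom
  have hmem : ∀ v : (𝓞 F)ˣ, π v = 1 → ψ v ∈ R := by
    intro v hv
    have h1 : Ideal.Quotient.mk (Ideal.span {(d : 𝓞 F)}) (v : 𝓞 F) =
        Ideal.Quotient.mk (Ideal.span {(d : 𝓞 F)}) 1 := by
      simpa [π] using congrArg Units.val hv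
    obtain ⟨c, hc⟩ := Ideal.mem_span_singleton'.mp (Ideal.Quotient.eq.mp h1)
    have hv' : (v : 𝓞 F) = 1 + d * c := by linear_combination -hc
    rw [hv', map_add, map_one, map_mul, map_intCast]
    exact R.add_mem R.one_mem (by simpa using hdR c)
  obtain ⟨m, hm, hum⟩ := isOfFinOrder_iff_pow_eq_one.mp (isOfFinOrder_of_finite (π u))
  have hum' : π (u ^ m) = 1 := by rw [map_pow, hum]
  let w : Rˣ :=
    { val := ⟨ψ ↑(u ^ m), hmem _ hum'⟩
      inv := ⟨ψ ↑(u ^ m)⁻¹, hmem _ (by rw [map_inv, hum', inv_one])⟩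
      val_inv := Subtype.ext (by
        change ψ _ * ψ _ = 1
        rw [← map_mul, Units.mul_inv, map_one])
      inv_val := Subtype.ext (by
        change ψ _ * ψ _ = 1
        rw [← map_mul, Units.inv_mul, map_one]) }
  obtain ⟨k, hk, hwk⟩ := isOfFinOrder_iff_pow_eq_one.mp (isOfFinOrder_of_finite w)
  refine isOfFinOrder_iff_pow_eq_one.mpr ⟨m * k, Nat.mul_pos hm hk, Units.ext (hψ ?_)⟩
  have hwk' : ψ ↑(u ^ m) ^ k = 1 := congrArg (fun z : Rˣ => ((z : R) : ℂ)) hwk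
  rw [pow_mul, Units.val_pow_eq_pow_val, map_pow, hwk', Units.val_one, map_one]

theorem finrank_eq_one_or_two_of_units_isOfFinOrder {F : Type*} [Field F] [NumberField F]
    (h : ∀ u : (𝓞 F)ˣ, IsOfFinOrder u) :
    Module.finrank ℚ F = 1 ∨ Module.finrank ℚ F = 2 ∧ IsTotallyComplex F := by
  have hrank : Units.rank F = 0 := by
    rw [← Units.finrank_eq, Module.finrank_eq_zero_iff]
    intro x
    obtain ⟨n, hn, hxn⟩ := isOfFinOrder_iff_pow_eq_one.mp (h x.toMul)
    refine ⟨n, by exact_mod_cast hn.ne', ?_⟩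
    rw [natCast_zsmul]
    exact congrArg Additive.ofMul hxn
  have hcard := InfinitePlace.card_eq_nrRealPlaces_add_nrComplexPlaces F
  have hdeg := InfinitePlace.card_add_two_mul_card_eq_rank F
  have hpos : 0 < Module.finrank ℚ F := Module.finrank_pos
  rw [Units.rank] at hrank
  rw [← nrRealPlaces_eq_zero_iff]
  lia

theorem finrank_eq_one_or_two_of_finite_units {F : Type*} [Field F] [NumberField F] (φ : F →+* ℂ)
    (R : Subring ℂ) [Finite Rˣ] (h : ∀ x : F, ∃ n : ℤ, n ≠ 0 ∧ (n : ℂ) * φ x ∈ R) :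
    Module.finrank ℚ F = 1 ∨
      Module.finrank ℚ F = 2 ∧ ¬ ComplexEmbedding.IsReal φ := by
  refine (finrank_eq_one_or_two_of_units_isOfFinOrder
    (isOfFinOrder_unit_of_finite_units φ R h)).imp_right ?_
  rintro ⟨h2, _⟩
  exact ⟨h2, IsTotallyComplex.complexEmbedding_not_isReal φ⟩

theorem stmt1 (R : Subring ℂ) (halg : ∀ x ∈ R, IsAlgebraic ℚ x)
    (hfin : Finite (↥R)ˣ) :
    Subfield.closure (R : Set ℂ) = (Rat.castHom ℂ).fieldRange ∨
      (Module.finrank ℚ ↥(Subfield.closure (R : Set ℂ)) = 2 ∧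
        ¬ (Subfield.closure (R : Set ℂ) : Set ℂ) ⊆ Set.range ((↑) : ℝ → ℂ)) := by
  set K := Subfield.closure (R : Set ℂ) with hK
  have hden : ∀ x ∈ K, ∃ n : ℤ, n ≠ 0 ∧ (n : ℂ) * x ∈ R := fun x hx =>
    exists_int_mul_mem_of_mem_subfield_closure R halg hx
  have hKalg : ∀ x ∈ K, IsIntegral ℚ x := by
    intro x hx
    obtain ⟨n, hn, hnx⟩ := hden x hx
    exact (isAlgebraic_of_intCast_mul hn (halg _ hnx)).isIntegral
  have hadjoin : ∀ s : Set ℂ, s ⊆ K → ∀ x ∈ IntermediateField.adjoin ℚ s, x ∈ K := by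
    intro s hs x hx
    refine (Subfield.closure_le.mpr (Set.union_subset ?_ hs) : _ ≤ K) hx
    rintro _ ⟨q, rfl⟩
    exact SubfieldClass.ratCast_mem K q
  have key : ∀ F : IntermediateField ℚ ℂ, FiniteDimensional ℚ F → (∀ x ∈ F, x ∈ K) →
      Module.finrank ℚ F = 1 ∨ Module.finrank ℚ F = 2 ∧
        ¬ ComplexEmbedding.IsReal (algebraMap F ℂ) := by
    intro F _ hF
    have : NumberField F := ⟨⟩
    exact finrank_eq_one_or_two_of_finite_units _ R fun x => hden x (hF x x.2)
  by_cases hrat : K ≤ (Rat.castHom ℂ).fieldRange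
  · refine Or.inl (le_antisymm hrat ?_)
    rintro _ ⟨q, rfl⟩
    exact SubfieldClass.ratCast_mem K q
  right
  obtain ⟨α, hαK, hα⟩ := SetLike.not_le_iff_exists.mp hrat
  let F := IntermediateField.adjoin ℚ {α}
  have hFfin : FiniteDimensional ℚ F := IntermediateField.adjoin.finiteDimensional (hKalg α hαK)
  have hFK : ∀ x ∈ F, x ∈ K := hadjoin {α} (Set.singleton_subset_iff.mpr hαK)
  have hF1 : Module.finrank ℚ F ≠ 1 := by
    intro h
    rw [IntermediateField.finrank_adjoin_simple_eq_one_iff, IntermediateField.mem_bot] at h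
    exact hα h
  obtain ⟨hF2, hFreal⟩ := (key F hFfin hFK).resolve_left hF1
  have hKF : K = F.toSubfield := by
    refine le_antisymm (fun β hβ => ?_) hFK
    let E := IntermediateField.adjoin ℚ {α, β}
    have hsub : ({α, β} : Set ℂ) ⊆ K := Set.pair_subset hαK hβ
    have hEfin : FiniteDimensional ℚ E :=
      IntermediateField.finiteDimensional_adjoin fun x hx => hKalg x (hsub hx)
    have hFE : F ≤ E := IntermediateField.adjoin.mono _ _ _ (by simp)
    have hE : Module.finrank ℚ E ≤ Module.finrank ℚ F := by
      have := key E hEfin (hadjoin _ hsub)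
      lia
    have hEq : F = E := IntermediateField.eq_of_le_of_finrank_le hFE hE
    change β ∈ F
    rw [hEq]
    exact IntermediateField.subset_adjoin ℚ _ (by simp)
  rw [hKF]
  refine ⟨?_, fun hreal => hFreal ?_⟩
  · let e : F.toSubfield ≃+ F := AddEquiv.refl F
    rw [← hF2, (e.toLinearEquiv (map_rat_smul e)).finrank_eq]
  · refine ComplexEmbedding.isReal_iff.mpr (RingHom.ext fun x => ?_)
    obtain ⟨r, hr⟩ := hreal x.2
    change (starRingEnd ℂ) (x : ℂ) = x
    rw [← hr, Complex.conj_ofReal]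
end

section
/- Let R₃ be a commutative ring and let R₁, R₂ be subrings of R₃. Suppose that R₁ ∩ R₂ has finite index in R₂ as an additive subgroup, and that for every positive integer n the quotient additive group R₁/nR₁ is finite. Then R₁ has finite index (as an additive subgroup) in R₁·R₂, the subring of R₃ generated by R₁ ∪ R₂. -/
/-- A finitely generated module annihilated by an ideal of finite quotient is finite. -/
theorem Module.finite_of_isTorsionBySet {R M : Type*} [CommRing R] [AddCommGroup M] [Module R M]
    [Module.Finite R M] (I : Ideal R) [Finite (R ⧸ I)] (h : Module.IsTorsionBySet R M I) :
    Finite M := by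
  let : Module (R ⧸ I) M := h.module
  have : IsScalarTower R (R ⧸ I) M := h.isScalarTower
  have : Module.Finite (R ⧸ I) M := Module.Finite.of_restrictScalars_finite R (R ⧸ I) M
  exact Module.finite_of_finite (R ⧸ I)

/-- The subring generated by two subrings lies in the span of the second over the first. -/
theorem Subring.closure_union_subset_span {A : Type*} [CommRing A] (R S : Subring A) :
    (Subring.closure ((R : Set A) ∪ (S : Set A)) : Set A) ⊆
      Submodule.span R (S : Set A) := by
  have hspan : (Algebra.adjoin R (S : Set A)).toSubmodule = Submodule.span R (S : Set A) := by
    rw [Algebra.adjoin_eq_span]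
    congr 2
    exact Submonoid.closure_eq S.toSubmonoid
  have hle : Subring.closure ((R : Set A) ∪ (S : Set A)) ≤
      (Algebra.adjoin R (S : Set A)).toSubring := by
    rw [Subring.closure_le]
    rintro x (hx | hx)
    · exact (Algebra.adjoin R (S : Set A)).algebraMap_mem ⟨x, hx⟩
    · exact Algebra.subset_adjoin hx
  intro x hx
  rw [← hspan]
  exact hle hx

theorem stmt2 {R₃ : Type*} [CommRing R₃] (R₁ R₂ : Subring R₃)
    (hidx : ((R₁.toAddSubgroup ⊓ R₂.toAddSubgroup).addSubgroupOf
        R₂.toAddSubgroup).FiniteIndex)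
    (hquot : ∀ n : ℕ, 0 < n → Finite (↥R₁ ⧸ Ideal.span {(n : ↥R₁)})) :
    (R₁.toAddSubgroup.addSubgroupOf
        (Subring.closure ((R₁ : Set R₃) ∪ (R₂ : Set R₃))).toAddSubgroup).FiniteIndex := by
  set H := (R₁.toAddSubgroup ⊓ R₂.toAddSubgroup).addSubgroupOf R₂.toAddSubgroup
  let N : Submodule R₁ R₃ := 1
  have mem_N (x : R₃) : x ∈ N ↔ x ∈ R₁ := by
    rw [Submodule.mem_one]
    exact ⟨fun ⟨y, hy⟩ => hy ▸ y.2, fun hx => ⟨⟨x, hx⟩, rfl⟩⟩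
  let P : Submodule R₁ (R₃ ⧸ N) := (Submodule.span R₁ (R₂ : Set R₃)).map N.mkQ
  have hP : P = Submodule.span R₁ (N.mkQ '' (R₂ : Set R₃)) := Submodule.map_span _ _
  have himage : (N.mkQ '' (R₂ : Set R₃)).Finite := by
    let f : R₂.toAddSubgroup →+ R₃ ⧸ N := N.mkQ.toAddMonoidHom.comp R₂.toAddSubgroup.subtype
    have hker : H ≤ f.ker := fun x hx =>
      (Submodule.Quotient.mk_eq_zero N).2 ((mem_N _).2 hx.1)
    have : Finite (R₂.toAddSubgroup ⧸ H) := AddSubgroup.finite_quotient_of_finiteIndex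
    refine (Set.finite_range (QuotientAddGroup.lift H f hker)).subset ?_
    rintro _ ⟨x, hx, rfl⟩
    exact ⟨QuotientAddGroup.mk ⟨x, hx⟩, rfl⟩
  have : Module.Finite R₁ P := by
    rw [hP]
    exact Module.Finite.span_of_finite R₁ himage
  have hn : 0 < H.index := Nat.pos_of_ne_zero hidx.index_ne_zero
  have := hquot _ hn
  have hsmul : ∀ x ∈ P, ((H.index : ℕ) : R₁) • x = 0 := by
    intro x hx
    rw [hP] at hx
    induction hx using Submodule.span_induction with
    | mem x hx =>
      obtain ⟨y, hy, rfl⟩ := hx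
      rw [← map_smul, Submodule.mkQ_apply, Submodule.Quotient.mk_eq_zero, mem_N,
        Nat.cast_smul_eq_nsmul]
      exact (H.nsmul_index_mem (⟨y, hy⟩ : R₂.toAddSubgroup)).1
    | zero => exact smul_zero _
    | add x y _ _ hx hy => rw [smul_add, hx, hy, add_zero]
    | smul a x _ hx => rw [smul_comm, hx, smul_zero]
  have : Finite P := by
    refine Module.finite_of_isTorsionBySet (Ideal.span {((H.index : ℕ) : R₁)}) ?_
    rw [← Module.isTorsionBySet_iff_is_torsion_by_span, Module.isTorsionBySet_singleton_iff]
    exact fun x => Subtype.ext (hsmul x x.2)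
  let T := (Subring.closure ((R₁ : Set R₃) ∪ (R₂ : Set R₃))).toAddSubgroup
  let g : T →+ R₃ ⧸ N := N.mkQ.toAddMonoidHom.comp T.subtype
  have : Finite g.range := by
    refine Set.Finite.subset (Set.toFinite (P : Set (R₃ ⧸ N))) ?_
    rintro _ ⟨x, rfl⟩
    exact ⟨x, Subring.closure_union_subset_span R₁ R₂ x.2, rfl⟩
  have hg : g.ker = R₁.toAddSubgroup.addSubgroupOf T := by
    ext x
    exact (Submodule.Quotient.mk_eq_zero N).trans (mem_N _)
  rw [← hg]
  exact AddSubgroup.finiteIndex_ker g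
end

section
/- Let R₁ ⊆ R₂ be an inclusion of commutative rings such that R₂/R₁ is finite as a quotient of additive abelian groups. Then the image of the unit group R₁^× in R₂^× is a subgroup of finite index in R₂^×. -/
/-- The largest ideal of the ambient ring that is contained in the given subring. -/
def Subring.conductor {R : Type*} [CommRing R] (S : Subring R) : Ideal R where
  carrier := {x | ∀ y, x * y ∈ S}
  add_mem' ha hb y := by
    rw [add_mul]
    exact S.add_mem (ha y) (hb y)
  zero_mem' y := by
    rw [zero_mul]
    exact S.zero_mem
  smul_mem' c x hx y := by
    rw [smul_eq_mul, mul_comm c x, mul_assoc]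
    exact hx (c * y)

theorem Subring.mem_of_mem_conductor {R : Type*} [CommRing R] {S : Subring R} {x : R}
    (hx : x ∈ S.conductor) : x ∈ S := by
  simpa using hx 1

theorem Subring.finite_quotient_conductor {R : Type*} [CommRing R] (S : Subring R)
    [Finite (R ⧸ S.toAddSubgroup)] : Finite (R ⧸ S.conductor) := by
  let f : R →+ (R ⧸ S.toAddSubgroup → R ⧸ S.toAddSubgroup) × (R ⧸ S.toAddSubgroup) :=
    (AddMonoidHom.mk' (fun r q => (QuotientAddGroup.mk (r * q.out) : R ⧸ S.toAddSubgroup))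
      fun a b => by ext q; simp [add_mul]).prod (QuotientAddGroup.mk' S.toAddSubgroup)
  have hker : f.ker ≤ S.conductor.toAddSubgroup := by
    intro r hr y
    obtain ⟨h₁, h₂⟩ := Prod.ext_iff.mp (AddMonoidHom.mem_ker.mp hr)
    have hrS : r ∈ S := (QuotientAddGroup.eq_zero_iff r).mp h₂
    let q : R ⧸ S.toAddSubgroup := QuotientAddGroup.mk y
    have hq : r * q.out ∈ S := (QuotientAddGroup.eq_zero_iff _).mp (congrFun h₁ q)
    have hy : -q.out + y ∈ S := QuotientAddGroup.eq.mp (QuotientAddGroup.out_eq' q)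
    have : r * y = r * q.out + r * (-q.out + y) := by ring
    rw [this]
    exact S.add_mem hq (S.mul_mem hrS hy)
  have : f.ker.FiniteIndex := AddSubgroup.finiteIndex_ker f
  have : S.conductor.toAddSubgroup.FiniteIndex := AddSubgroup.finiteIndex_of_le hker
  exact AddSubgroup.finite_quotient_of_finiteIndex (H := S.conductor.toAddSubgroup)

theorem stmt3 {R₂ : Type*} [CommRing R₂] (R₁ : Subring R₂)
    (hfin : Finite (R₂ ⧸ R₁.toAddSubgroup)) :
    (Units.map (R₁.subtype.toMonoidHom : ↥R₁ →* R₂)).range.FiniteIndex := by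
  have := R₁.finite_quotient_conductor
  let g : R₂ˣ →* (R₂ ⧸ R₁.conductor)ˣ := Units.map (Ideal.Quotient.mk R₁.conductor).toMonoidHom
  have hmem : ∀ u ∈ g.ker, (u : R₂) ∈ R₁ := by
    intro u hu
    have h : Ideal.Quotient.mk R₁.conductor u = Ideal.Quotient.mk R₁.conductor 1 :=
      congrArg Units.val (MonoidHom.mem_ker.mp hu)
    have h' := Subring.mem_of_mem_conductor (Ideal.Quotient.eq.mp h)
    simpa using R₁.add_mem h' R₁.one_mem
  have : g.ker.FiniteIndex := Subgroup.finiteIndex_ker g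
  refine Subgroup.finiteIndex_of_le (H := g.ker) fun u hu => ?_
  exact ⟨⟨⟨u, hmem u hu⟩, ⟨(u⁻¹ : R₂ˣ), hmem _ (inv_mem hu)⟩,
    Subtype.ext u.mul_inv, Subtype.ext u.inv_mul⟩, Units.ext rfl⟩
end

section
/- Let L be a number field, realized as a subfield of ℂ, and let R be a subring of L whose unit group R^× is finite. Then either R ⊆ ℤ, or there exists an imaginary quadratic subfield K of L (a subfield with [K : ℚ] = 2 and K ⊄ ℝ) such that R is contained in the ring of integers 𝒪_K of K. -/
open NumberField in
/-- If `R` is a subring of `F` such that every element of `F` has a nonzero integer multiple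
in `R`, then `R` contains a nonzero integer multiple of `𝓞 F`. -/
theorem exists_mul_ringOfIntegers_mem {F : Type*} [Field F] [NumberField F] (R : Subring F)
    (hR : ∀ y : F, ∃ n : ℤ, n ≠ 0 ∧ (n : F) * y ∈ R) :
    ∃ m : ℤ, m ≠ 0 ∧ ∀ c : 𝓞 F, (m : F) * c ∈ R := by
  choose n hn0 hn using hR
  let b := RingOfIntegers.basis F
  refine ⟨∏ i, n (b i), Finset.prod_ne_zero_iff.mpr fun i _ => hn0 _, fun c => ?_⟩
  rw [← b.sum_repr c]
  simp only [map_sum, Finset.mul_sum, zsmul_eq_mul, map_mul, map_intCast]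
  refine sum_mem fun i _ => ?_
  obtain ⟨k, hk⟩ := Finset.dvd_prod_of_mem (fun i => n (b i)) (Finset.mem_univ i)
  rw [hk]
  have : (((n (b i) * k : ℤ) : F)) * ((b.repr c i : F) * (b i : F)) =
      ((k * b.repr c i : ℤ) : F) * ((n (b i) : F) * (b i : F)) := by
    push_cast; ring
  rw [this]
  exact mul_mem (intCast_mem R _) (hn _)

open NumberField in
/-- A nonzero algebraic integer all of whose inverse powers have a uniformly bounded denominator
with respect to a subring `R` with finite unit group is a root of unity. -/
theorem exists_pow_eq_one_of_mul_inv_pow_mem {F : Type*} [Field F] [NumberField F]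
    (R : Subring F) [Finite (↥R)ˣ] {m : ℤ} (hm : m ≠ 0) {β : 𝓞 F} (hβ : β ≠ 0)
    (hR : ∀ (c : 𝓞 F) (k : ℕ), (m : F) * c * (β : F)⁻¹ ^ k ∈ R) :
    ∃ n : ℕ, 0 < n ∧ β ^ n = 1 := by
  have hβF : (β : F) ≠ 0 := by simpa using hβ
  have : Finite (𝓞 F ⧸ Ideal.span {(m : 𝓞 F)}) :=
    Ring.HasFiniteQuotients.finiteQuotient (by simpa using hm)
  obtain ⟨i, j, hne, hij⟩ := Finite.exists_ne_map_eq_of_infinite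
    (fun i : ℕ => Ideal.Quotient.mk (Ideal.span {(m : 𝓞 F)}) (β ^ i))
  wlog hlt : i < j generalizing i j
  · exact this j i hne.symm hij.symm (by lia)
  rw [eq_comm, Ideal.Quotient.eq, Ideal.mem_span_singleton] at hij
  obtain ⟨c, hc⟩ := hij
  have hcF : (β : F) ^ j - (β : F) ^ i = m * c := by
    have := congrArg (fun z : 𝓞 F => (z : F)) hc
    simpa using this
  obtain ⟨d, rfl⟩ := Nat.exists_eq_add_of_lt hlt
  have hcancel (k : ℕ) : (β : F) ^ k * (β : F)⁻¹ ^ k = 1 := by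
    rw [← mul_pow, mul_inv_cancel₀ hβF, one_pow]
  have h1 : (β : F) ^ (d + 1) = 1 + m * c * (β : F)⁻¹ ^ i := by
    rw [← hcF]; linear_combination (1 - (β : F) ^ (d + 1)) * hcancel i
  have h2 : (β : F)⁻¹ ^ (d + 1) = 1 - m * c * (β : F)⁻¹ ^ (i + d + 1) := by
    rw [← hcF]
    linear_combination ((β : F) ^ (d + 1) * (β : F)⁻¹ ^ (d + 1) - (β : F)⁻¹ ^ (d + 1)) *
      hcancel i + hcancel (d + 1)
  let u : (↥R)ˣ :=
    { val := ⟨(β : F) ^ (d + 1), h1 ▸ add_mem (one_mem R) (hR c i)⟩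
      inv := ⟨(β : F)⁻¹ ^ (d + 1), h2 ▸ sub_mem (one_mem R) (hR c _)⟩
      val_inv := Subtype.ext (by simp [hβF])
      inv_val := Subtype.ext (by simp [hβF]) }
  obtain ⟨k, hk, huk⟩ := isOfFinOrder_iff_pow_eq_one.mp (isOfFinOrder_of_finite u)
  refine ⟨(d + 1) * k, by positivity, RingOfIntegers.coe_injective ?_⟩
  have := congrArg (fun v : (↥R)ˣ => ((v : R) : F)) huk
  simpa [u, pow_mul] using this

open NumberField nonZeroDivisors in
/-- A subring with finite unit group and full fraction field consists of algebraic integers. -/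
theorem isIntegral_of_mem_of_finite_units_s5 {F : Type*} [Field F] [NumberField F]
    (R : Subring F) [Finite (↥R)ˣ] (hR : ∀ y : F, ∃ n : ℤ, n ≠ 0 ∧ (n : F) * y ∈ R)
    {x : F} (hx : x ∈ R) : IsIntegral ℤ x := by
  obtain ⟨m, hm0, hm⟩ := exists_mul_ringOfIntegers_mem R hR
  let J : FractionalIdeal (𝓞 F)⁰ F := 1 + FractionalIdeal.spanSingleton (𝓞 F)⁰ x
  have hone : (1 : FractionalIdeal (𝓞 F)⁰ F) ≤ J := le_sup_left
  have hxJ : x ∈ J :=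
    (le_sup_right : FractionalIdeal.spanSingleton (𝓞 F)⁰ x ≤ J)
      (FractionalIdeal.mem_spanSingleton_self _ x)
  have hJ0 : J ≠ 0 := fun h => by
    rw [h] at hone
    exact one_ne_zero (le_antisymm hone (FractionalIdeal.zero_le _))
  have hpow : ∀ n : ℕ, ∀ z ∈ J ^ n, (m : F) * z ∈ R := by
    intro n
    induction n with
    | zero =>
      intro z hz
      rw [pow_zero] at hz
      obtain ⟨c, rfl⟩ := (FractionalIdeal.mem_one_iff _).mp hz
      exact hm c
    | succ n ih =>
      intro z hz
      rw [pow_succ] at hz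
      refine FractionalIdeal.mul_induction_on hz (fun a ha b hb => ?_) fun a b ha hb => ?_
      · obtain ⟨p, hp, q, hq, rfl⟩ := (FractionalIdeal.mem_add _ _ _).mp hb
        obtain ⟨c, rfl⟩ := (FractionalIdeal.mem_one_iff _).mp hp
        obtain ⟨d, rfl⟩ := (FractionalIdeal.mem_spanSingleton _).mp hq
        have h1 := ih _ (Submodule.smul_mem (J ^ n : FractionalIdeal (𝓞 F)⁰ F).coeToSubmodule c ha)
        have h2 := ih _ (Submodule.smul_mem (J ^ n : FractionalIdeal (𝓞 F)⁰ F).coeToSubmodule d ha)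
        have h3 := add_mem h1 (mul_mem h2 hx)
        rw [Algebra.smul_def, Algebra.smul_def] at h3
        rw [Algebra.smul_def]
        convert h3 using 1
        ring
      · rw [mul_add]
        exact add_mem ha hb
  obtain ⟨h, hpos, hh⟩ := isOfFinOrder_iff_pow_eq_one.mp
    (isOfFinOrder_of_finite (ClassGroup.mk F (Units.mk0 J hJ0)))
  rw [← map_pow, ClassGroup.mk_eq_one_iff, FractionalIdeal.isPrincipal_iff] at hh
  obtain ⟨γ, hγ⟩ := hh
  replace hγ : J ^ h = FractionalIdeal.spanSingleton (𝓞 F)⁰ γ := by simpa using hγ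
  have hle : J ≤ J ^ h := le_self_pow₀ hone hpos.ne'
  obtain ⟨β, hβ⟩ : ∃ β : 𝓞 F, β • γ = 1 := by
    rw [← FractionalIdeal.mem_spanSingleton (𝓞 F)⁰, ← hγ]
    exact hle (hone (FractionalIdeal.one_mem_one _))
  rw [Algebra.smul_def] at hβ
  have hβ0 : β ≠ 0 := by rintro rfl; simp at hβ
  have hinv : (β : F)⁻¹ = γ := inv_eq_of_mul_eq_one_right hβ
  obtain ⟨n, hn, hβn⟩ := exists_pow_eq_one_of_mul_inv_pow_mem R hm0 hβ0 fun c k => by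
    rw [hinv, mul_assoc]
    refine hpow (h * k) _ ?_
    rw [pow_mul, hγ, FractionalIdeal.spanSingleton_pow]
    exact (FractionalIdeal.mem_spanSingleton _).mpr ⟨c, Algebra.smul_def _ _⟩
  have hγint : IsIntegral ℤ γ := by
    refine IsIntegral.of_pow hn ?_
    have : (β : F) ^ n = 1 := by rw [← map_pow, hβn, map_one]
    rw [← hinv, inv_pow, this, inv_one]
    exact isIntegral_one
  have hxγ := hle hxJ
  rw [hγ, FractionalIdeal.mem_spanSingleton] at hxγ
  obtain ⟨c, rfl⟩ := hxγ
  rw [Algebra.smul_def]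
  exact (RingOfIntegers.isIntegral_coe c).mul hγint

open NumberField in
/-- A number field containing a subring with finite unit group and full fraction field has a
unique infinite place. -/
theorem card_infinitePlace_eq_one_of_finite_units_s5 {F : Type*} [Field F] [NumberField F]
    (R : Subring F) [Finite (↥R)ˣ] (hR : ∀ y : F, ∃ n : ℤ, n ≠ 0 ∧ (n : F) * y ∈ R) :
    Fintype.card (InfinitePlace F) = 1 := by
  obtain ⟨m, hm0, hm⟩ := exists_mul_ringOfIntegers_mem R hR
  have htors (u : (𝓞 F)ˣ) : IsOfFinOrder u := by
    obtain ⟨n, hn, hu⟩ := exists_pow_eq_one_of_mul_inv_pow_mem R hm0 u.ne_zero fun c k => by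
      have : ((u : 𝓞 F) : F)⁻¹ = ((u⁻¹ : (𝓞 F)ˣ) : 𝓞 F) := by
        simp
      rw [this, mul_assoc, ← map_pow, ← map_mul]
      exact hm _
    exact isOfFinOrder_iff_pow_eq_one.mpr ⟨n, hn, Units.ext (by simpa using hu)⟩
  have hrank : Units.rank F = 0 := by
    rw [← Units.finrank_eq, Module.finrank_eq_zero_iff]
    intro u
    obtain ⟨n, hn, hu⟩ := isOfFinOrder_iff_pow_eq_one.mp (htors u.toMul)
    exact ⟨n, by exact_mod_cast hn.ne', by simpa using congrArg Additive.ofMul hu⟩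
  have : 0 < Fintype.card (InfinitePlace F) := Fintype.card_pos
  rw [Units.rank] at hrank
  lia

/-- Every element of the algebra generated over `ℚ` by a subring has a
nonzero integer multiple in the subring. -/
theorem exists_intCast_mul_mem_of_mem_adjoin {A : Type*} [CommRing A] [Algebra ℚ A]
    (R : Subring A) {y : A} (hy : y ∈ Algebra.adjoin ℚ (R : Set A)) :
    ∃ n : ℤ, n ≠ 0 ∧ (n : A) * y ∈ R := by
  induction hy using Algebra.adjoin_induction with
  | mem x hx => exact ⟨1, one_ne_zero, by simpa using hx⟩
  | algebraMap q =>
    refine ⟨q.den, by simp, ?_⟩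
    have : (((q.den : ℤ)) : A) * algebraMap ℚ A q = (q.num : A) := by
      rw [← map_intCast (algebraMap ℚ A), ← map_mul, ← map_intCast (algebraMap ℚ A)]
      congr 1
      exact_mod_cast Rat.den_mul_eq_num q
    rw [this]
    exact intCast_mem R _
  | add x y _ _ hx hy =>
    obtain ⟨a, ha, hax⟩ := hx
    obtain ⟨b, hb, hby⟩ := hy
    refine ⟨a * b, mul_ne_zero ha hb, ?_⟩
    have := add_mem (mul_mem (intCast_mem R b) hax) (mul_mem (intCast_mem R a) hby)
    convert this using 1
    push_cast; ring
  | mul x y _ _ hx hy =>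
    obtain ⟨a, ha, hax⟩ := hx
    obtain ⟨b, hb, hby⟩ := hy
    refine ⟨a * b, mul_ne_zero ha hb, ?_⟩
    convert mul_mem hax hby using 1
    push_cast; ring

open NumberField in
theorem stmt5 (L : Subfield ℂ) (hL : FiniteDimensional ℚ ↥L)
    (R : Subring ℂ) (hRL : (R : Set ℂ) ⊆ (L : Set ℂ)) (hfin : Finite (↥R)ˣ) :
    (R : Set ℂ) ⊆ Set.range ((↑) : ℤ → ℂ) ∨
      ∃ K : Subfield ℂ, (K : Set ℂ) ⊆ (L : Set ℂ) ∧ Module.finrank ℚ ↥K = 2 ∧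
        ¬ (K : Set ℂ) ⊆ Set.range ((↑) : ℝ → ℂ) ∧
        ∀ x ∈ R, x ∈ K ∧ IsIntegral ℤ x := by
  let L' : IntermediateField ℚ ℂ := L.toIntermediateField fun q => by simp
  have : FiniteDimensional ℚ L' := hL
  let F : IntermediateField ℚ ℂ := IntermediateField.adjoin ℚ (R : Set ℂ)
  have hFL : F ≤ L' := IntermediateField.adjoin_le_iff.mpr hRL
  have : FiniteDimensional ℚ F :=
    Module.Finite.of_injective (IntermediateField.inclusion hFL).toLinearMap
      (IntermediateField.inclusion_injective hFL)
  have : NumberField F := ⟨⟩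
  have hRF : ∀ x ∈ R, x ∈ F := fun x hx => IntermediateField.subset_adjoin ℚ _ hx
  let S : Subring F := R.comap (algebraMap F ℂ)
  have hS : ∀ y : F, ∃ n : ℤ, n ≠ 0 ∧ (n : F) * y ∈ S := by
    intro y
    have halg : ∀ x ∈ (R : Set ℂ), IsAlgebraic ℚ x := fun x hx =>
      (Algebra.IsAlgebraic.isAlgebraic (⟨x, hRF x hx⟩ : F)).algebraMap
    have hy : (y : ℂ) ∈ F.toSubalgebra := y.2
    rw [IntermediateField.adjoin_toSubalgebra_of_isAlgebraic halg] at hy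
    obtain ⟨n, hn, hny⟩ := exists_intCast_mul_mem_of_mem_adjoin R hy
    exact ⟨n, hn, by simpa [S, Subring.mem_comap] using hny⟩
  let f : S →+* R := (algebraMap F ℂ).restrict S R fun _ hx => hx
  have hf : Function.Injective f := fun a b hab =>
    Subtype.ext (Subtype.ext (congrArg (fun z : R => (z : ℂ)) hab))
  have : Finite (↥S)ˣ := Finite.of_injective _ (Units.map_injective (f := (f : S →* R)) hf)
  have hint : ∀ x ∈ R, IsIntegral ℤ x := fun x hx =>
    (isIntegral_of_mem_of_finite_units_s5 S hS (x := ⟨x, hRF x hx⟩) hx).map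
      ((algebraMap F ℂ).toIntAlgHom)
  have hcard := card_infinitePlace_eq_one_of_finite_units_s5 S hS
  rw [InfinitePlace.card_eq_nrRealPlaces_add_nrComplexPlaces] at hcard
  have hdeg := InfinitePlace.card_add_two_mul_card_eq_rank F
  by_cases hreal : InfinitePlace.nrRealPlaces F = 0
  · right
    refine ⟨F.toSubfield, hFL, ?_, fun hFR => ?_, fun x hx => ⟨hRF x hx, hint x hx⟩⟩
    · change Module.finrank ℚ F = 2
      lia
    · have hφ : ComplexEmbedding.IsReal (algebraMap F ℂ) := by
        refine RingHom.ext fun x => ?_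
        obtain ⟨r, hr⟩ := hFR x.2
        change (starRingEnd ℂ) (x : ℂ) = x
        rw [← hr, Complex.conj_ofReal]
      have := nrRealPlaces_eq_zero_iff.mp hreal
      exact InfinitePlace.not_isReal_iff_isComplex.mpr
        (this.isComplex (InfinitePlace.mk (algebraMap F ℂ))) ⟨_, hφ, rfl⟩
  · left
    intro x hx
    have hbot : F = ⊥ := IntermediateField.finrank_eq_one_iff.mp (by lia)
    obtain ⟨q, rfl⟩ := IntermediateField.mem_bot.mp (hbot ▸ hRF x hx)
    have hq : IsIntegral ℤ q :=
      (isIntegral_algebraMap_iff (algebraMap ℚ ℂ).injective).mp (hint _ hx)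
    obtain ⟨n, rfl⟩ := IsIntegrallyClosed.isIntegral_iff.mp hq
    exact ⟨n, by simp⟩
end

section
/- Let S be a Dedekind domain whose ideal class group is a torsion group, and let R be a ring with S ⊆ R ⊆ Frac(S) (R a subring of the fraction field of S containing S). If S ≠ R, then the image of the unit group S^× in R^× is a subgroup of infinite index in R^×. -/
/-- If `R` is a subring of the fraction field containing `S` and `a / b`, then `R` contains
`z / b ^ n` for every `z` in the `n`-th power of the ideal `(a, b)`. -/
theorem Subring.div_pow_mem_of_mem_span_pair_pow {S K : Type*} [CommRing S] [Field K] [Algebra S K]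
    {R : Subring K} (hS : (algebraMap S K).range ≤ R) {a b : S} (hb : algebraMap S K b ≠ 0)
    (hab : algebraMap S K a / algebraMap S K b ∈ R) (n : ℕ) {z : S}
    (hz : z ∈ Ideal.span {a, b} ^ n) :
    algebraMap S K z / algebraMap S K b ^ n ∈ R := by
  have hmem (s : S) : algebraMap S K s ∈ R := hS ⟨s, rfl⟩
  induction n generalizing z with
  | zero => simpa using hmem z
  | succ n ih =>
    rw [pow_succ] at hz
    refine Submodule.mul_induction_on hz (fun u hu v hv => ?_) fun u v hu hv => ?_
    · obtain ⟨s, t, rfl⟩ := Ideal.mem_span_pair.mp hv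
      have key : algebraMap S K (u * (s * a + t * b)) / algebraMap S K b ^ (n + 1) =
          algebraMap S K u / algebraMap S K b ^ n *
            (algebraMap S K s * (algebraMap S K a / algebraMap S K b) + algebraMap S K t) := by
        simp only [map_mul, map_add]
        field_simp
        ring
      rw [key]
      exact R.mul_mem (ih hu) (R.add_mem (R.mul_mem (hmem s) hab) (hmem t))
    · rw [map_add, add_div]
      exact R.add_mem hu hv

/-- In a Dedekind domain with torsion class group, every nonzero ideal has a positive power which
is principal. -/
theorem ClassGroup.exists_pow_eq_span_singleton {S : Type*} [CommRing S]
    [IsDedekindDomain S] (hTor : IsMulTorsion (ClassGroup S)) {I : Ideal S} (hI : I ≠ ⊥) :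
    ∃ n, 0 < n ∧ ∃ c, I ^ n = Ideal.span {c} := by
  obtain ⟨n, hn, h⟩ := isOfFinOrder_iff_pow_eq_one.mp
    (hTor (ClassGroup.mk0 ⟨I, mem_nonZeroDivisors_of_ne_zero hI⟩))
  rw [← map_pow, ClassGroup.mk0_eq_one_iff] at h
  exact ⟨n, hn, h.principal⟩

theorem stmt6 (S : Type*) [CommRing S] [IsDomain S] [IsDedekindDomain S]
    (hTor : Monoid.IsTorsion (ClassGroup S))
    (R : Subring (FractionRing S))
    (hS : (algebraMap S (FractionRing S)).range ≤ R)
    (hne : (algebraMap S (FractionRing S)).range ≠ R) :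
    (Units.map ((Subring.inclusion hS).comp
        (algebraMap S (FractionRing S)).rangeRestrict).toMonoidHom).range.index = 0 := by
  set f := algebraMap S (FractionRing S) with hf
  have finj : Function.Injective f := IsFractionRing.injective S (FractionRing S)
  obtain ⟨x, hxR, hxS⟩ := SetLike.exists_of_lt (lt_of_le_of_ne hS hne)
  obtain ⟨a, b, hb, rfl⟩ := IsFractionRing.div_surjective (A := S) x
  have hb0 : b ≠ 0 := nonZeroDivisors.ne_zero hb
  have hfb : f b ≠ 0 := (map_ne_zero_iff f finj).mpr hb0
  obtain ⟨n, hn, c, hc⟩ := ClassGroup.exists_pow_eq_span_singleton hTor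
    (I := Ideal.span {a, b}) fun h => hb0 (Ideal.span_eq_bot.mp h b (by simp))
  have hdvd {z : S} (hz : z ∈ Ideal.span {a, b}) : c ∣ z ^ n :=
    Ideal.mem_span_singleton.mp (hc ▸ Ideal.pow_mem_pow hz n)
  obtain ⟨d, hd⟩ := hdvd (z := b) (Ideal.subset_span (by simp))
  have hca : c ∣ a ^ n := hdvd (Ideal.subset_span (by simp))
  have hyR : f c / f b ^ n ∈ R := Subring.div_pow_mem_of_mem_span_pair_pow hS hfb hxR n
    (hc ▸ Ideal.mem_span_singleton_self c)
  have hyd : f c / f b ^ n * f d = 1 := by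
    rw [div_mul_eq_mul_div, ← map_mul, ← hd, map_pow, div_self (pow_ne_zero n hfb)]
  let y : Rˣ := Units.mkOfMulEqOne ⟨_, hyR⟩ ⟨f d, hS ⟨d, rfl⟩⟩ (Subtype.ext hyd)
  by_contra hindex
  obtain ⟨k, hk, -, u, hu⟩ := Subgroup.exists_pow_mem_of_index_ne_zero hindex y
  have hfu : f u = (f c / f b ^ n) ^ k := congrArg (fun v : Rˣ => ((v : R) : FractionRing S)) hu
  have hck : (b ^ n) ^ k ∣ c ^ k := by
    refine ⟨u, finj ?_⟩
    rw [map_mul, hfu, div_pow]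
    simp only [map_pow]
    field_simp
  have hba : b ∣ a := by
    rw [← IsIntegrallyClosed.pow_dvd_pow_iff (n := n * k) (by positivity), pow_mul, pow_mul]
    exact hck.trans (pow_dvd_pow_of_dvd hca k)
  obtain ⟨e, rfl⟩ := hba
  exact hxS ⟨e, by rw [← hf, map_mul, mul_div_cancel_left₀ _ hfb]⟩
end

section
/- Let S be a principal ideal domain and let R be a ring with S ⊆ R ⊆ Frac(S). If S ≠ R, then R has infinitely many units, i.e., the group R^× is infinite. -/
/-- Over a principal ideal domain, every overring inside a fraction field that contains an element
outside the base ring contains the inverse of a nonzero nonunit of the base ring. -/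
theorem exists_inv_mem_of_not_mem_range {S K : Type*} [CommRing S] [IsDomain S]
    [IsPrincipalIdealRing S] [Field K] [Algebra S K] [IsFractionRing S K] (R : Subring K)
    (hS : (algebraMap S K).range ≤ R) {x : K} (hxR : x ∈ R) (hxS : x ∉ (algebraMap S K).range) :
    ∃ b : S, b ≠ 0 ∧ ¬ IsUnit b ∧ (algebraMap S K b)⁻¹ ∈ R := by
  obtain ⟨a, b, hab, rfl⟩ := IsFractionRing.exists_reduced_fraction (A := S) x
  have hb : (b : S) ≠ 0 := nonZeroDivisors.ne_zero b.2
  have hbK : algebraMap S K b ≠ 0 := by simp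
  rw [IsFractionRing.mk'_eq_div] at hxR hxS
  refine ⟨b, hb, fun hu => hxS ?_, ?_⟩
  · obtain ⟨c, hc⟩ := hu.dvd (a := a)
    exact ⟨c, by rw [hc, map_mul, mul_div_cancel_left₀ _ hbK]⟩
  · obtain ⟨u, v, huv⟩ := hab.isCoprime
    have h := congrArg (algebraMap S K) huv
    simp only [map_add, map_mul, map_one] at h
    have hinv : (algebraMap S K b)⁻¹ =
        algebraMap S K u * (algebraMap S K a / algebraMap S K b) + algebraMap S K v := by
      field_simp
      linear_combination -h
    rw [hinv]
    exact R.add_mem (R.mul_mem (hS ⟨u, rfl⟩) hxR) (hS ⟨v, rfl⟩)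

theorem stmt7 (S : Type*) [CommRing S] [IsDomain S] [IsPrincipalIdealRing S]
    (R : Subring (FractionRing S))
    (hS : (algebraMap S (FractionRing S)).range ≤ R)
    (hne : (algebraMap S (FractionRing S)).range ≠ R) :
    Infinite (↥R)ˣ := by
  obtain ⟨x, hxR, hxS⟩ := SetLike.exists_of_lt (lt_of_le_of_ne hS hne)
  obtain ⟨b, hb, hbu, hinv⟩ := exists_inv_mem_of_not_mem_range R hS hxR hxS
  have hbK : algebraMap S (FractionRing S) b ≠ 0 := by simpa using hb
  let w : (↥R)ˣ :=
    ⟨⟨algebraMap S (FractionRing S) b, hS ⟨b, rfl⟩⟩, ⟨_, hinv⟩,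
      Subtype.ext (mul_inv_cancel₀ hbK), Subtype.ext (inv_mul_cancel₀ hbK)⟩
  refine Infinite.of_injective (fun n : ℕ => w ^ n) fun m n hmn => ?_
  have hK : algebraMap S (FractionRing S) (b ^ m) = algebraMap S (FractionRing S) (b ^ n) := by
    simpa [w] using congrArg (fun y : (↥R)ˣ => ((y : R) : FractionRing S)) hmn
  exact pow_injective_of_not_isUnit hbu hb (IsFractionRing.injective S (FractionRing S) hK)
end

section
/- Let K be a field and R a subring of K. Suppose that the set of pairs (a, b) ∈ (R \ {0}) × (R \ {0}) with a·b = 2 is infinite. Then the set of non-zero frieze patterns of height 1 over R is infinite. -/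
/-- A non-zero frieze pattern of height `n` over a subset `R` of a field `K`:
a map `c : ℤ × ℤ → K` with the boundary conditions `c i i = 0`, `c i (i+1) = 1`,
`c i (n+i+2) = 1`, `c i (n+i+3) = 0`, entries `c i j` in `R \ {0}` for
`i+1 ≤ j ≤ n+i+2`, and all adjacent `2 × 2` determinants equal to `1`. -/
def IsFrieze {K : Type*} [Field K] (R : Set K) (n : ℕ) (c : ℤ → ℤ → K) : Prop :=
  (∀ i : ℤ, c i i = 0 ∧ c i (i + 1) = 1 ∧
      c i ((n : ℤ) + i + 2) = 1 ∧ c i ((n : ℤ) + i + 3) = 0) ∧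
  (∀ i j : ℤ, i + 1 ≤ j → j ≤ (n : ℤ) + i + 2 → c i j ∈ R ∧ c i j ≠ 0) ∧
  (∀ i j : ℤ, i + 1 ≤ j → j ≤ (n : ℤ) + i + 2 →
    c i j * c (i + 1) (j + 1) - c i (j + 1) * c (i + 1) j = 1)

/-- The height-one frieze array whose only non-trivial diagonal alternates between `p.1` and
`p.2`. -/
def alternatingFrieze {K : Type*} [Field K] (p : K × K) (i j : ℤ) : K :=
  if j - i = 1 ∨ j - i = 3 then 1
  else if j - i = 2 then (if Even i then p.1 else p.2)
  else 0

theorem alternatingFrieze_injective {K : Type*} [Field K] :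
    Function.Injective (alternatingFrieze : K × K → ℤ → ℤ → K) := by
  intro p q h
  have h₀ := congrFun (congrFun h 0) 2
  have h₁ := congrFun (congrFun h 1) 3
  norm_num [alternatingFrieze] at h₀ h₁
  exact Prod.ext h₀ h₁

theorem isFrieze_alternatingFrieze {K : Type*} [Field K] (R : Subring K) {p : K × K}
    (ha : p.1 ∈ R) (ha0 : p.1 ≠ 0) (hb : p.2 ∈ R) (hb0 : p.2 ≠ 0) (hab : p.1 * p.2 = 2) :
    IsFrieze (R : Set K) 1 (alternatingFrieze p) := by
  refine ⟨fun i ↦ ?_, fun i j h₁ h₂ ↦ ?_, fun i j h₁ h₂ ↦ ?_⟩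
  · refine ⟨?_, ?_, ?_, ?_⟩ <;> unfold alternatingFrieze <;> grind
  all_goals
    push_cast at h₂
    obtain ⟨k, rfl⟩ : ∃ k, j = i + k := ⟨j - i, by ring⟩
    have hk₁ : 1 ≤ k := by linarith
    have hk₃ : k ≤ 3 := by linarith
    have hs : i + k + 1 - (i + 1) = k := by ring
    have ht : i + k + 1 - i = k + 1 := by ring
    have hu : i + k - (i + 1) = k - 1 := by ring
    simp only [alternatingFrieze, add_sub_cancel_left, hs, ht, hu, Int.even_add_one]
    interval_cases k <;> by_cases hi : Even i <;>
      norm_num [hi, ha, ha0, hb, hb0, hab, mul_comm p.2, R.one_mem]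

theorem stmt8 {K : Type*} [Field K] (R : Subring K)
    (h : {p : K × K |
        p.1 ∈ R ∧ p.1 ≠ 0 ∧ p.2 ∈ R ∧ p.2 ≠ 0 ∧ p.1 * p.2 = 2}.Infinite) :
    {c : ℤ → ℤ → K | IsFrieze (R : Set K) 1 c}.Infinite := by
  refine Set.infinite_of_injOn_mapsTo alternatingFrieze_injective.injOn ?_ h
  rintro p ⟨ha, ha0, hb, hb0, hab⟩
  exact isFrieze_alternatingFrieze R ha ha0 hb hb0 hab
end

section
/- Let R be a subring of ℂ that is discrete as a subset of ℂ (with the topology induced from ℂ). Then there exists a squarefree integer d < 0 such that R ⊆ ℚ(√d). -/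
/-- In a discrete subring, an element of the real span of `1` and `z` has a nonzero integer multiple
in the integer span of `1` and `z`. -/
theorem exists_int_combination_of_discrete (R : Subring ℂ) (hdisc : DiscreteTopology ↥R)
    {z w : ℂ} (hz : z ∈ R) (hw : w ∈ R) (x y : ℝ) (h : w = x + y * z) :
    ∃ N a b : ℤ, N ≠ 0 ∧ (N : ℂ) * w = a + b * z := by
  have hclosed : IsClosed (R : Set ℂ) :=
    haveI : DiscreteTopology R.toAddSubgroup := hdisc
    AddSubgroup.isClosed_of_discrete (H := R.toAddSubgroup)
  have hfin : ((Metric.closedBall (0 : ℂ) (1 + ‖z‖)) ∩ (R : Set ℂ)).Finite :=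
    Metric.finite_isBounded_inter_isClosed (DiscreteTopology.isDiscrete (s := (R : Set ℂ)))
      Metric.isBounded_closedBall hclosed
  let f : ℤ → ℂ := fun n => n * w - ⌊n * x⌋ - ⌊n * y⌋ * z
  have hf : ∀ n, f n ∈ (Metric.closedBall (0 : ℂ) (1 + ‖z‖)) ∩ (R : Set ℂ) := by
    intro n
    refine ⟨?_, ?_⟩
    · have hfract : f n = (Int.fract (n * x) : ℝ) + (Int.fract (n * y) : ℝ) * z := by
        simp only [f, h, Int.fract]
        push_cast
        ring
      rw [mem_closedBall_zero_iff, hfract]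
      refine (norm_add_le _ _).trans ?_
      rw [norm_mul, Complex.norm_real, Complex.norm_real, Real.norm_of_nonneg (Int.fract_nonneg _),
        Real.norm_of_nonneg (Int.fract_nonneg _)]
      exact add_le_add (Int.fract_lt_one _).le
        (mul_le_of_le_one_left (norm_nonneg _) (Int.fract_lt_one _).le)
    · exact R.sub_mem (R.sub_mem (R.mul_mem (intCast_mem R n) hw) (intCast_mem R _))
        (R.mul_mem (intCast_mem R _) hz)
  have := hfin.to_subtype
  obtain ⟨m, n, hmn, heq⟩ := Finite.exists_ne_map_eq_of_infinite
    (fun n : ℤ => (⟨f n, hf n⟩ :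
      ((Metric.closedBall (0 : ℂ) (1 + ‖z‖)) ∩ (R : Set ℂ) : Set ℂ)))
  have heq : f m = f n := congrArg Subtype.val heq
  refine ⟨m - n, ⌊m * x⌋ - ⌊n * x⌋, ⌊m * y⌋ - ⌊n * y⌋, sub_ne_zero.2 hmn, ?_⟩
  simp only [f] at heq
  push_cast
  linear_combination heq

theorem Subfield.mem_of_int_combination (K : Subfield ℂ) {z w : ℂ} (hz : z ∈ K) {N a b : ℤ}
    (hN : N ≠ 0) (h : (N : ℂ) * w = a + b * z) : w ∈ K := by
  have hN' : (N : ℂ) ≠ 0 := Int.cast_ne_zero.2 hN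
  have hw : w = (a + b * z) / N := by
    rw [← h]
    field_simp
  rw [hw]
  exact K.div_mem (K.add_mem (intCast_mem K a) (K.mul_mem (intCast_mem K b) hz)) (intCast_mem K N)

theorem Complex.exists_eq_add_mul_of_im_ne_zero {z : ℂ} (hz : z.im ≠ 0) (w : ℂ) :
    ∃ x y : ℝ, w = x + y * z := by
  refine ⟨w.re - w.im / z.im * z.re, w.im / z.im, ?_⟩
  apply Complex.ext <;> simp [hz]

/-- A non-real root of an integer quadratic lies in an imaginary quadratic field. -/
theorem exists_mem_Qsqrt_of_quadratic {z : ℂ} (hz : z.im ≠ 0) {N a b : ℤ} (hN : N ≠ 0)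
    (h : (N : ℂ) * z ^ 2 = a + b * z) :
    ∃ d : ℤ, d < 0 ∧ Squarefree d ∧ z ∈ Qsqrt d := by
  have hsq : (2 * N * z - b) ^ 2 = ((b ^ 2 + 4 * a * N : ℤ) : ℂ) := by
    push_cast
    linear_combination 4 * (N : ℂ) * h
  have hD : b ^ 2 + 4 * a * N < 0 := by
    have him : (2 * N * z - b : ℂ).im ≠ 0 := by
      simp [hz, hN]
    have hre := congrArg Complex.re hsq
    have him2 := congrArg Complex.im hsq
    generalize (2 * N * z - b : ℂ) = u at him hre him2
    simp only [pow_two u, Complex.mul_re, Complex.mul_im, Complex.intCast_re,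
      Complex.intCast_im] at hre him2
    have hure : u.re = 0 := by
      have : u.re * u.im = 0 := by linarith
      exact (mul_eq_zero.1 this).resolve_right him
    have : ((b ^ 2 + 4 * a * N : ℤ) : ℝ) < 0 := by
      rw [← hre, hure]
      have := mul_self_pos.2 him
      linarith
    exact_mod_cast this
  obtain ⟨d, s, hds, hd⟩ := Nat.sq_mul_squarefree (b ^ 2 + 4 * a * N).natAbs
  have hds' : b ^ 2 + 4 * a * N = s ^ 2 * (-d : ℤ) := by
    have : ((s ^ 2 * d : ℕ) : ℤ) = -(b ^ 2 + 4 * a * N) := by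
      rw [hds, Int.ofNat_natAbs_of_nonpos hD.le]
    push_cast at this
    linarith
  have hs : (s : ℂ) ≠ 0 := by
    rintro hs
    have : s = 0 := by exact_mod_cast hs
    simp [this] at hds'
    omega
  refine ⟨-d, ?_, ?_, ?_⟩
  · have := hd.ne_zero
    omega
  · rw [← Int.squarefree_natAbs]
    simpa using hd
  · have hroot : (2 * N * z - b) / s ∈ Qsqrt (-d) := by
      apply Subfield.subset_closure
      rw [Set.mem_ofPred_eq, div_pow, hsq, hds']
      push_cast
      field_simp
    refine (Qsqrt (-d)).mem_of_int_combination hroot (N := 2 * N) (a := b) (b := s) (by omega) ?_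
    push_cast
    field_simp
    ring

theorem stmt13 (R : Subring ℂ) (hdisc : DiscreteTopology ↥R) :
    ∃ d : ℤ, d < 0 ∧ Squarefree d ∧ (R : Set ℂ) ⊆ (Qsqrt d : Set ℂ) := by
  by_cases hR : ∃ z ∈ R, z.im ≠ 0
  · obtain ⟨z, hz, him⟩ := hR
    have hcomb : ∀ w ∈ R, ∃ N a b : ℤ, N ≠ 0 ∧ (N : ℂ) * w = a + b * z := fun w hw =>
      have ⟨x, y, h⟩ := Complex.exists_eq_add_mul_of_im_ne_zero him w
      exists_int_combination_of_discrete R hdisc hz hw x y h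
    obtain ⟨N, a, b, hN, h⟩ := hcomb (z ^ 2) (R.pow_mem hz 2)
    obtain ⟨d, hd, hsf, hzd⟩ := exists_mem_Qsqrt_of_quadratic him hN h
    refine ⟨d, hd, hsf, fun w hw => ?_⟩
    obtain ⟨N, a, b, hN, h⟩ := hcomb w hw
    exact (Qsqrt d).mem_of_int_combination hzd hN h
  · push Not at hR
    refine ⟨-1, by norm_num, isUnit_one.neg.squarefree, fun w hw => ?_⟩
    obtain ⟨N, a, b, hN, h⟩ := exists_int_combination_of_discrete R hdisc R.zero_mem hw w.re 0
      (by apply Complex.ext <;> simp [hR w hw])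
    exact (Qsqrt (-1)).mem_of_int_combination (Qsqrt (-1)).zero_mem hN h
end

section
/- Let c = (c_{i,j}) be a non-zero frieze pattern of height n over the set of real numbers x with |x| > 1/√2, and for each entry set ε_{i,j} = 1 if c_{i,j} > 0 and ε_{i,j} = −1 if c_{i,j} < 0. Then for all i ∈ ℤ and all j with i+2 ≤ j ≤ n+i+1 one has ε_{i,j}·ε_{i+1,j}·ε_{i,j+1}·ε_{i+1,j+1} = 1. -/
/-- The sign `ε` of a (nonzero) real number: `1` if positive, `-1` if negative. -/
noncomputable def eps (x : ℝ) : ℝ := if 0 < x then 1 else -1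

theorem eps_of_pos {x : ℝ} (hx : 0 < x) : eps x = 1 := if_pos hx

theorem eps_of_neg {x : ℝ} (hx : x < 0) : eps x = -1 := if_neg hx.not_gt

theorem eps_mul {x y : ℝ} (hx : x ≠ 0) (hy : y ≠ 0) : eps (x * y) = eps x * eps y := by
  rcases hx.lt_or_gt with hx | hx <;> rcases hy.lt_or_gt with hy | hy
  · rw [eps_of_pos (mul_pos_of_neg_of_neg hx hy), eps_of_neg hx, eps_of_neg hy]; norm_num
  · rw [eps_of_neg (mul_neg_of_neg_of_pos hx hy), eps_of_neg hx, eps_of_pos hy]; norm_num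
  · rw [eps_of_neg (mul_neg_of_pos_of_neg hx hy), eps_of_pos hx, eps_of_neg hy]; norm_num
  · rw [eps_of_pos (mul_pos hx hy), eps_of_pos hx, eps_of_pos hy]; norm_num

theorem half_lt_abs_mul {x y : ℝ} (hx : 1 / Real.sqrt 2 < |x|) (hy : 1 / Real.sqrt 2 < |y|) :
    1 / 2 < |x * y| := by
  have h : (1 / Real.sqrt 2) * (1 / Real.sqrt 2) = 1 / 2 := by
    rw [div_mul_div_comm, one_mul, Real.mul_self_sqrt zero_le_two]
  rw [abs_mul, ← h]
  exact mul_lt_mul'' hx hy (by positivity) (by positivity)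

theorem stmt15 (n : ℕ) (c : ℤ → ℤ → ℝ)
    (hc : IsFrieze {x : ℝ | 1 / Real.sqrt 2 < |x|} n c) :
    ∀ i j : ℤ, i + 2 ≤ j → j ≤ (n : ℤ) + i + 1 →
      eps (c i j) * eps (c (i + 1) j) * eps (c i (j + 1)) * eps (c (i + 1) (j + 1)) = 1 := by
  obtain ⟨-, hR, hdet⟩ := hc
  intro i j hij hji
  obtain ⟨ha, -⟩ := hR i j (by omega) (by omega)
  obtain ⟨hb, -⟩ := hR (i + 1) j (by omega) (by omega)
  obtain ⟨hc, -⟩ := hR i (j + 1) (by omega) (by omega)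
  obtain ⟨hd, -⟩ := hR (i + 1) (j + 1) (by omega) (by omega)
  have had := half_lt_abs_mul ha hd
  have hcb := half_lt_abs_mul hc hb
  have h := hdet i j (by omega) (by omega)
  have hpos : 0 < (c i j * c (i + 1) (j + 1)) * (c i (j + 1) * c (i + 1) j) := by
    rcases lt_abs.1 had with h1 | h1 <;> rcases lt_abs.1 hcb with h2 | h2 <;> nlinarith
  rw [← eps_of_pos hpos]
  have hne := hpos.ne'
  simp only [mul_ne_zero_iff] at hne
  obtain ⟨⟨ha0, hd0⟩, hc0, hb0⟩ := hne
  rw [eps_mul (mul_ne_zero ha0 hd0) (mul_ne_zero hc0 hb0), eps_mul ha0 hd0, eps_mul hc0 hb0]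
  ring
end

section
/- Let c = (c_{i,j}) be a non-zero frieze pattern of height n over the set of real numbers x with |x| > 1/√2, and for each entry set ε_{i,j} = 1 if c_{i,j} > 0 and ε_{i,j} = −1 if c_{i,j} < 0. Then for all i ∈ ℤ and all integers ℓ with 1 ≤ ℓ ≤ n+1 one has ε_{i,i+2}·ε_{i+1,i+2}·ε_{i,i+ℓ+1}·ε_{i+1,i+ℓ+1} = 1. -/
/-- Two reals of absolute value greater than `1 / 2` that differ by `1` have the same sign. -/
theorem mul_pos_of_sub_eq_one {p q : ℝ} (hp : 1 / 2 < |p|) (hq : 1 / 2 < |q|) (h : p - q = 1) :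
    0 < p * q := by
  rcases lt_abs.1 hp with hp | hp <;> rcases lt_abs.1 hq with hq | hq <;> nlinarith

/-- The sign of `c i j * c (i + 1) j` does not depend on `j`. -/
theorem IsFrieze.mul_pos {n : ℕ} {c : ℤ → ℤ → ℝ}
    (hc : IsFrieze {x : ℝ | 1 / Real.sqrt 2 < |x|} n c) (i j : ℤ) (hj : i + 2 ≤ j) :
    j ≤ (n : ℤ) + i + 2 →
      0 < (c i (i + 2) * c (i + 1) (i + 2)) * (c i j * c (i + 1) j) := by
  obtain ⟨-, hR, hdet⟩ := hc
  induction j, hj using Int.leInduction with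
  | base =>
    intro h
    have h₁ := (hR i (i + 2) (by lia) h).2
    have h₂ := (hR (i + 1) (i + 2) (by lia) (by lia)).2
    exact mul_self_pos.2 (mul_ne_zero h₁ h₂)
  | succ j hj ih =>
    intro h
    have hstep := mul_pos_of_sub_eq_one
      (half_lt_abs_mul (hR i j (by lia) (by lia)).1 (hR (i + 1) (j + 1) (by lia) (by lia)).1)
      (half_lt_abs_mul (hR i (j + 1) (by lia) (by lia)).1 (hR (i + 1) j (by lia) (by lia)).1)
      (hdet i j (by lia) (by lia))
    have hprod := _root_.mul_pos (ih (by lia)) hstep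
    refine pos_of_mul_pos_left (b := (c i j * c (i + 1) j) ^ 2) ?_ (sq_nonneg _)
    linarith

theorem stmt16 (n : ℕ) (c : ℤ → ℤ → ℝ)
    (hc : IsFrieze {x : ℝ | 1 / Real.sqrt 2 < |x|} n c) :
    ∀ i ℓ : ℤ, 1 ≤ ℓ → ℓ ≤ (n : ℤ) + 1 →
      eps (c i (i + 2)) * eps (c (i + 1) (i + 2)) *
        eps (c i (i + ℓ + 1)) * eps (c (i + 1) (i + ℓ + 1)) = 1 := by
  intro i ℓ h₁ h₂
  have hne (k j : ℤ) (h : k + 1 ≤ j) (h' : j ≤ (n : ℤ) + k + 2) : c k j ≠ 0 := (hc.2.1 k j h h').2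
  have ha := hne i (i + 2) (by lia) (by lia)
  have hb := hne (i + 1) (i + 2) (by lia) (by lia)
  have hd := hne i (i + ℓ + 1) (by lia) (by lia)
  have he := hne (i + 1) (i + ℓ + 1) (by lia) (by lia)
  rw [← eps_mul ha hb, ← eps_mul (mul_ne_zero ha hb) hd,
    ← eps_mul (mul_ne_zero (mul_ne_zero ha hb) hd) he]
  refine eps_of_pos ?_
  rw [mul_assoc (c i (i + 2) * c (i + 1) (i + 2))]
  exact hc.mul_pos i (i + ℓ + 1) (by lia) (by lia)
end

section
/- Let d be a negative squarefree integer and let 𝒪_d be the ring of integers of ℚ(√d). If d ∈ {−1, −2, −3, −7, −11}, then the frieze subring 𝒪_d° equals 𝒪_d. If d ∉ {−1, −2, −3, −7, −11}, then 𝒪_d° = ℤ; equivalently, every entry c_{i,j} (i+1 ≤ j ≤ n+i+2) of every non-zero frieze pattern of any height n over 𝒪_d is a rational integer. -/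
/-- The frieze subring `R°` of a subring `R ≤ ℂ`: the subring generated by all
entries of all non-zero frieze patterns over `R` (of all heights). -/
def friezeSubring (R : Subring ℂ) : Subring ℂ :=
  Subring.closure {x : ℂ | ∃ (n : ℕ) (c : ℤ → ℤ → ℂ) (i j : ℤ),
    IsFrieze (R : Set ℂ) n c ∧ i + 1 ≤ j ∧ j ≤ (n : ℤ) + i + 2 ∧ c i j = x}

/-- `𝒪_d`: the ring of integers of `ℚ(√d)`, i.e. the elements of `ℚ(√d) ⊆ ℂ`
that are integral over `ℤ`. -/
noncomputable def Od (d : ℤ) : Subring ℂ :=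
  (integralClosure ℤ ℂ).toSubring ⊓ (Qsqrt d).toSubring

open Complex in
/-- The square root of `d` in the upper half plane, for `d < 0`. -/
noncomputable def sqrtNeg (d : ℤ) : ℂ := (Real.sqrt (-(d : ℝ)) : ℂ) * I

theorem sqrtNeg_sq {d : ℤ} (hd : d < 0) : sqrtNeg d ^ 2 = d := by
  have h : (0 : ℝ) ≤ -(d : ℝ) := by
    have : (d : ℝ) < 0 := by exact_mod_cast hd
    linarith
  rw [sqrtNeg, mul_pow, Complex.I_sq, ← Complex.ofReal_pow, Real.sq_sqrt h]
  push_cast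
  ring

theorem conj_sqrtNeg (d : ℤ) : (starRingEnd ℂ) (sqrtNeg d) = -sqrtNeg d := by
  simp [sqrtNeg]

theorem sqrtNeg_mem_Qsqrt {d : ℤ} (hd : d < 0) : sqrtNeg d ∈ Qsqrt d :=
  Subfield.subset_closure (sqrtNeg_sq hd)

theorem rat_sq_sub_ne_zero {d : ℤ} (hd : d < 0) {p q : ℚ} (h : ¬(p = 0 ∧ q = 0)) :
    p ^ 2 - d * q ^ 2 ≠ 0 := by
  have hd' : (d : ℚ) < 0 := by exact_mod_cast hd
  intro h0
  have hq : q = 0 := by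
    by_contra hq
    have : 0 < q ^ 2 := by positivity
    nlinarith [sq_nonneg p]
  subst hq
  apply h
  simpa using h0

theorem exists_rat_of_mem_Qsqrt {d : ℤ} (hd : d < 0) {z : ℂ} (hz : z ∈ Qsqrt d) :
    ∃ p q : ℚ, z = p + q * sqrtNeg d := by
  have hs := sqrtNeg_sq hd
  induction hz using Subfield.closure_induction with
  | mem x hx =>
    have : (x - sqrtNeg d) * (x + sqrtNeg d) = 0 := by
      have hx' : x ^ 2 = d := hx
      linear_combination hx' - hs
    rcases mul_eq_zero.mp this with h | h
    · exact ⟨0, 1, by push_cast; linear_combination h⟩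
    · exact ⟨0, -1, by push_cast; linear_combination h⟩
  | one => exact ⟨1, 0, by simp⟩
  | add x y _ _ hx hy =>
    obtain ⟨p, q, rfl⟩ := hx
    obtain ⟨p', q', rfl⟩ := hy
    exact ⟨p + p', q + q', by push_cast; ring⟩
  | neg x _ hx =>
    obtain ⟨p, q, rfl⟩ := hx
    exact ⟨-p, -q, by push_cast; ring⟩
  | inv x _ hx =>
    obtain ⟨p, q, rfl⟩ := hx
    by_cases h : p = 0 ∧ q = 0
    · exact ⟨0, 0, by simp [h.1, h.2]⟩
    · have hN : ((p : ℂ) ^ 2 - d * (q : ℂ) ^ 2) ≠ 0 := by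
        exact_mod_cast rat_sq_sub_ne_zero hd h
      refine ⟨p / (p ^ 2 - d * q ^ 2), -q / (p ^ 2 - d * q ^ 2), ?_⟩
      apply inv_eq_of_mul_eq_one_right
      push_cast
      calc ((p : ℂ) + q * sqrtNeg d) *
            (p / (p ^ 2 - d * q ^ 2) + -q / (p ^ 2 - d * q ^ 2) * sqrtNeg d)
          = (p ^ 2 - sqrtNeg d ^ 2 * q ^ 2) / (p ^ 2 - d * q ^ 2) := by ring
        _ = 1 := by rw [hs, div_self hN]
  | mul x y _ _ hx hy =>
    obtain ⟨p, q, rfl⟩ := hx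
    obtain ⟨p', q', rfl⟩ := hy
    exact ⟨p * p' + d * (q * q'), p * q' + q * p', by
      push_cast; linear_combination (q : ℂ) * q' * hs⟩

theorem exists_int_of_isIntegral_ratCast {p : ℚ} (h : IsIntegral ℤ (p : ℂ)) :
    ∃ T : ℤ, (T : ℚ) = p := by
  have h1 : IsIntegral ℤ (algebraMap ℚ ℂ p) := by simpa using h
  rw [isIntegral_algebraMap_iff (algebraMap ℚ ℂ).injective] at h1
  simpa using IsIntegrallyClosed.isIntegral_iff.mp h1

theorem exists_int_of_squarefree_mul_sq {d M : ℤ} (hsf : Squarefree d) {q : ℚ}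
    (h : (d : ℚ) * q ^ 2 = M) : ∃ U : ℤ, (U : ℚ) = q := by
  have hden : (q.den : ℚ) ≠ 0 := by exact_mod_cast q.den_nz
  have h1 : d * q.num ^ 2 = M * (q.den : ℤ) ^ 2 := by
    have h2 : (d : ℚ) * (q.num : ℚ) ^ 2 = M * (q.den : ℚ) ^ 2 := by
      rw [← h, mul_assoc, ← mul_pow, Rat.mul_den_eq_num]
    exact_mod_cast h2
  have hc : IsCoprime ((q.den : ℤ) ^ 2) (q.num ^ 2) :=
    (Rat.isCoprime_num_den q).symm.pow
  have h3 : (q.den : ℤ) * q.den ∣ d := by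
    rw [← sq]
    exact hc.dvd_of_dvd_mul_right ⟨M, by rw [h1]; ring⟩
  have h4 : q.den = 1 := by
    have := Int.isUnit_iff.mp (hsf _ h3)
    have := q.den_pos
    omega
  exact ⟨q.num, by rw [← Rat.mul_den_eq_num, h4]; simp⟩

theorem mem_Od_iff {d : ℤ} (hd : d < 0) (hsf : Squarefree d) {z : ℂ} :
    z ∈ Od d ↔ ∃ T U : ℤ, 2 * z = T + U * sqrtNeg d ∧ 4 ∣ T ^ 2 - d * U ^ 2 := by
  have hs := sqrtNeg_sq hd
  constructor
  · rintro ⟨hz : IsIntegral ℤ z, hz'⟩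
    obtain ⟨p, q, hpq⟩ := exists_rat_of_mem_Qsqrt hd hz'
    have hconj : (starRingEnd ℂ) z = p - q * sqrtNeg d := by
      rw [hpq]
      simp [conj_sqrtNeg, sub_eq_add_neg]
    have hc : IsIntegral ℤ ((starRingEnd ℂ) z) :=
      hz.map (starRingEnd ℂ).toIntAlgHom
    obtain ⟨T, hT⟩ := exists_int_of_isIntegral_ratCast (p := 2 * p) (by
      have e : ((2 * p : ℚ) : ℂ) = z + (starRingEnd ℂ) z := by
        rw [hconj, hpq]; push_cast; ring
      rw [e]
      exact hz.add hc)
    obtain ⟨N, hN⟩ := exists_int_of_isIntegral_ratCast (p := p ^ 2 - d * q ^ 2) (by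
      have e : ((p ^ 2 - d * q ^ 2 : ℚ) : ℂ) = z * (starRingEnd ℂ) z := by
        rw [hconj, hpq]; push_cast; linear_combination (q : ℂ) ^ 2 * hs
      rw [e]
      exact hz.mul hc)
    obtain ⟨U, hU⟩ := exists_int_of_squarefree_mul_sq (M := T ^ 2 - 4 * N) (q := 2 * q) hsf (by
      push_cast; rw [hT, hN]; ring)
    refine ⟨T, U, ?_, N, ?_⟩
    · have hT' : (T : ℂ) = 2 * p := by exact_mod_cast congrArg (Rat.cast : ℚ → ℂ) hT
      have hU' : (U : ℂ) = 2 * q := by exact_mod_cast congrArg (Rat.cast : ℚ → ℂ) hU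
      rw [hT', hU', hpq]; ring
    · have : (T : ℚ) ^ 2 - d * U ^ 2 = 4 * N := by rw [hT, hU, hN]; ring
      exact_mod_cast this
  · rintro ⟨T, U, hz, N, hN⟩
    have hN' : (T : ℂ) ^ 2 - d * U ^ 2 = 4 * N := by exact_mod_cast hN
    have hz' : z = (T + U * sqrtNeg d) / 2 := by rw [← hz]; ring
    refine ⟨?_, ?_⟩
    · change IsIntegral ℤ z
      refine ⟨Polynomial.X ^ 2 + (Polynomial.C (-T) * Polynomial.X + Polynomial.C N), ?_, ?_⟩
      · apply Polynomial.monic_X_pow_add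
        exact Polynomial.degree_linear_lt
      · simp only [Polynomial.eval₂_add, Polynomial.eval₂_mul, Polynomial.eval₂_C,
          Polynomial.eval₂_X_pow, Polynomial.eval₂_X, algebraMap_int_eq]
        simp only [eq_intCast]
        rw [hz']
        push_cast
        linear_combination (-1 / 4 : ℂ) * hN' + (U : ℂ) ^ 2 / 4 * hs
    · change z ∈ Qsqrt d
      rw [hz']
      exact div_mem (add_mem (intCast_mem _ _)
        (mul_mem (intCast_mem _ _) (sqrtNeg_mem_Qsqrt hd))) (ofNat_mem _ 2)

theorem norm_sq_of_mem_Od {d : ℤ} (hd : d < 0) {z : ℂ} {T U : ℤ}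
    (hz : 2 * z = T + U * sqrtNeg d) : 4 * ‖z‖ ^ 2 = T ^ 2 - d * U ^ 2 := by
  have hs := sqrtNeg_sq hd
  have hz' : z = (T + U * sqrtNeg d) / 2 := by rw [← hz]; ring
  have h : (4 : ℂ) * (‖z‖ : ℂ) ^ 2 = T ^ 2 - d * U ^ 2 := by
    rw [← Complex.mul_conj', hz']
    simp only [map_div₀, map_add, map_mul, conj_sqrtNeg, map_intCast, map_ofNat]
    linear_combination -(U : ℂ) ^ 2 * hs
  exact_mod_cast h

theorem int_or_two_le_norm {d : ℤ} (hd : d < 0) (hsf : Squarefree d)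
    (hmem : d ∉ ({-1, -2, -3, -7, -11} : Set ℤ)) {z : ℂ} (hz : z ∈ Od d) :
    (∃ m : ℤ, z = m) ∨ 2 ≤ ‖z‖ := by
  obtain ⟨T, U, hTU, N, hN⟩ := (mem_Od_iff hd hsf).mp hz
  by_cases hU : U = 0
  · subst hU
    left
    have hT : Even (T ^ 2) := ⟨2 * N, by linarith⟩
    obtain ⟨m, rfl⟩ := (Int.even_pow.mp hT).1
    refine ⟨m, ?_⟩
    push_cast at hTU
    linear_combination hTU / 2
  · right
    have hnorm := norm_sq_of_mem_Od hd hTU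
    have hNnorm : ‖z‖ ^ 2 = N := by
      have : (T : ℝ) ^ 2 - d * U ^ 2 = 4 * N := by exact_mod_cast hN
      linarith
    suffices h4 : 4 ≤ N by
      have : (4 : ℝ) ≤ N := by exact_mod_cast h4
      nlinarith [norm_nonneg z]
    by_contra! hlt
    have hU1 : 1 ≤ U ^ 2 := by have : 0 < U ^ 2 := by positivity
                               omega
    have hdl : -12 ≤ d := by nlinarith [sq_nonneg T]
    have hT4 : T ^ 2 % 4 = 0 ∨ T ^ 2 % 4 = 1 := by
      rcases Int.even_or_odd' T with ⟨k, rfl | rfl⟩ <;> ring_nf <;> omega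
    have hU4 : U ^ 2 % 4 = 0 ∨ U ^ 2 % 8 = 1 := by
      rcases Int.even_or_odd' U with ⟨k, rfl | rfl⟩
      · ring_nf; omega
      · right
        have := Int.even_mul_succ_self k
        obtain ⟨l, hl⟩ := this
        have : (2 * k + 1) ^ 2 = 8 * l + 1 := by linear_combination 4 * hl
        omega
    have hT0 := sq_nonneg T
    simp only [Set.mem_insert_iff, Set.mem_singleton_iff, not_or] at hmem
    have sf4 : ¬ (4 : ℤ) ∣ d := fun h => by
      have := Int.isUnit_iff.mp (hsf 2 h)
      omega
    have sf9 : ¬ (9 : ℤ) ∣ d := fun h => by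
      have := Int.isUnit_iff.mp (hsf 3 h)
      omega
    generalize T ^ 2 = t at *
    generalize U ^ 2 = u at *
    interval_cases d <;> omega

/-- The determinant of two vectors in the plane. -/
def planeDet (v w : ℂ × ℂ) : ℂ := v.1 * w.2 - w.1 * v.2

/-- In a closed polygon of vectors with unit sides, some short diagonal has absolute value
less than `2`. -/
theorem exists_norm_planeDet_lt_two {v : ℕ → ℂ × ℂ} {m : ℕ}
    (hunit : ∀ i, i ≤ m + 1 → ‖planeDet (v i) (v (i + 1))‖ = 1)
    (hends : ‖planeDet (v 0) (v (m + 2))‖ = 1) :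
    ∃ k ≤ m, ‖planeDet (v k) (v (k + 2))‖ < 2 := by
  by_contra! h
  have key : ∀ k, k ≤ m + 1 → 1 ≤ ‖planeDet (v 0) (v (k + 1))‖ - ‖planeDet (v 0) (v k)‖ := by
    intro k
    induction k with
    | zero => 
      intro _
      rw [hunit 0 (by omega)]
      simp [planeDet]
    | succ k ih =>
      intro hk
      have ih := ih (by omega)
      have hrel : planeDet (v k) (v (k + 2)) * planeDet (v 0) (v (k + 1)) =
          planeDet (v (k + 1)) (v (k + 2)) * planeDet (v 0) (v k) +
          planeDet (v k) (v (k + 1)) * planeDet (v 0) (v (k + 2)) := by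
        simp only [planeDet]; ring
      have h1 := congrArg norm hrel
      have h2 := norm_add_le (planeDet (v (k + 1)) (v (k + 2)) * planeDet (v 0) (v k))
        (planeDet (v k) (v (k + 1)) * planeDet (v 0) (v (k + 2)))
      rw [← h1] at h2
      simp only [norm_mul] at h2
      have hu := hunit (k + 1) hk
      rw [add_assoc] at hu
      rw [hunit k (by omega), hu, one_mul, one_mul] at h2
      have h3 := h k (by omega)
      have h4 := mul_le_mul_of_nonneg_right h3 (norm_nonneg (planeDet (v 0) (v (k + 1))))
      have e : k + 1 + 1 = k + 2 := rfl
      rw [e]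
      linarith
  have grow : ∀ k, k ≤ m + 2 → (k : ℝ) ≤ ‖planeDet (v 0) (v k)‖ := by
    intro k
    induction k with
    | zero => intro _; simp
    | succ k ih =>
      intro hk
      have := ih (by omega)
      have := key k (by omega)
      push_cast
      linarith
  have := grow (m + 2) le_rfl
  rw [hends] at this
  push_cast at this
  have : (0 : ℝ) ≤ m := by positivity
  linarith

/-- If every nonzero short element of `R` is `±1`, then a closed polygon of vectors with unit sides
and all diagonals nonzero in `R` has integer diagonals. -/
theorem planeDet_int_of_polygon {R : Set ℂ}
    (hR : ∀ z ∈ R, z ≠ 0 → ‖z‖ < 2 → z = 1 ∨ z = -1) (m : ℕ) :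
    ∀ v : ℕ → ℂ × ℂ,
      (∀ i, i ≤ m → planeDet (v i) (v (i + 1)) = 1 ∨ planeDet (v i) (v (i + 1)) = -1) →
      (planeDet (v 0) (v (m + 1)) = 1 ∨ planeDet (v 0) (v (m + 1)) = -1) →
      (∀ i j, i < j → j ≤ m + 1 → planeDet (v i) (v j) ∈ R ∧ planeDet (v i) (v j) ≠ 0) →
      ∀ i j, i ≤ m + 1 → j ≤ m + 1 → ∃ a : ℤ, planeDet (v i) (v j) = a := by
  have norm_one : ∀ z : ℂ, z = 1 ∨ z = -1 → ‖z‖ = 1 := by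
    rintro z (rfl | rfl) <;> simp
  have swap : ∀ x y, planeDet x y = -planeDet y x := fun x y => by simp only [planeDet]; ring
  have self : ∀ x, planeDet x x = 0 := fun x => by simp only [planeDet]; ring
  induction m with
  | zero =>
    intro v hunit _ _ i j hi hj
    have h01 : ∃ a : ℤ, planeDet (v 0) (v 1) = a := by
      rcases hunit 0 le_rfl with h | h
      · exact ⟨1, by simpa using h⟩
      · exact ⟨-1, by simpa using h⟩
    interval_cases i <;> interval_cases j
    · exact ⟨0, by simp [self]⟩
    · exact h01
    · obtain ⟨a, ha⟩ := h01
      exact ⟨-a, by rw [swap, ha]; simp⟩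
    · exact ⟨0, by simp [self]⟩
  | succ m ih =>
    intro v hunit hends hdiag
    obtain ⟨k, hk, hk2⟩ := exists_norm_planeDet_lt_two
      (fun i hi => norm_one _ (hunit i hi)) (norm_one _ hends)
    have hshort := hR _ (hdiag k (k + 2) (by omega) (by omega)).1
      (hdiag k (k + 2) (by omega) (by omega)).2 hk2
    -- delete the vertex `k + 1`
    let σ : ℕ → ℕ := fun i => if i ≤ k then i else i + 1
    have hσ : ∀ i, i ≤ k → σ i = i := fun i hi => if_pos hi
    have hσ' : ∀ i, k < i → σ i = i + 1 := fun i hi => if_neg (by omega)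
    have hsub := ih (fun i => v (σ i)) ?_ ?_ ?_
    rotate_left
    · intro i hi
      rcases lt_trichotomy i k with h | h | h
      · simpa only [hσ i h.le, hσ (i + 1) h] using hunit i (by omega)
      · subst h
        simpa only [hσ i le_rfl, hσ' (i + 1) (Nat.lt_succ_self i)] using hshort
      · simpa only [hσ' i h, hσ' (i + 1) (by omega)] using hunit (i + 1) (by omega)
    · simpa only [hσ 0 (Nat.zero_le k), hσ' (m + 1) (by omega)] using hends
    · intro i j hij hj
      apply hdiag
      · simp only [σ]; split_ifs <;> omega
      · simp only [σ]; split_ifs <;> omega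
    have hother : ∀ i j, i ≤ m + 2 → j ≤ m + 2 → i ≠ k + 1 → j ≠ k + 1 →
        ∃ a : ℤ, planeDet (v i) (v j) = a := by
      have surj : ∀ i, i ≤ m + 2 → i ≠ k + 1 → ∃ i', i' ≤ m + 1 ∧ σ i' = i := by
        intro i hi hne
        by_cases h : i ≤ k
        · exact ⟨i, by omega, hσ i h⟩
        · exact ⟨i - 1, by omega, by rw [hσ' _ (by omega)]; omega⟩
      intro i j hi hj hi' hj'
      obtain ⟨i', hi1, rfl⟩ := surj i hi hi'
      obtain ⟨j', hj1, rfl⟩ := surj j hj hj'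
      exact hsub i' j' hi1 hj1
    have hvertex : ∀ j, j ≤ m + 2 → j ≠ k + 1 → ∃ a : ℤ, planeDet (v (k + 1)) (v j) = a := by
      intro j hj hne
      obtain ⟨a, ha⟩ := hother k j (by omega) hj (by omega) hne
      obtain ⟨b, hb⟩ := hother (k + 2) j (by omega) hj (by omega) hne
      have hrel : planeDet (v k) (v (k + 2)) * planeDet (v (k + 1)) (v j) =
          planeDet (v (k + 1)) (v (k + 2)) * planeDet (v k) (v j) +
          planeDet (v k) (v (k + 1)) * planeDet (v (k + 2)) (v j) := by
        simp only [planeDet]; ring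
      rw [ha, hb] at hrel
      have toInt : ∀ z : ℂ, z = 1 ∨ z = -1 → ∃ e : ℤ, z = e := by
        rintro z (rfl | rfl)
        · exact ⟨1, by simp⟩
        · exact ⟨-1, by simp⟩
      obtain ⟨e, he⟩ := toInt _ (hunit k (by omega))
      obtain ⟨f, hf⟩ := toInt _ (hunit (k + 1) (by omega))
      rw [he, show planeDet (v (k + 1)) (v (k + 2)) = f from hf] at hrel
      rcases hshort with h | h
      · exact ⟨f * a + e * b, by rw [h] at hrel; push_cast; linear_combination hrel⟩
      · exact ⟨-(f * a + e * b), by rw [h] at hrel; push_cast; linear_combination -hrel⟩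
    intro i j hi hj
    by_cases hi' : i = k + 1
    · by_cases hj' : j = k + 1
      · exact ⟨0, by rw [hi', hj', self]; simp⟩
      · rw [hi']; exact hvertex j hj hj'
    · by_cases hj' : j = k + 1
      · obtain ⟨a, ha⟩ := hvertex i hi hi'
        exact ⟨-a, by rw [hj', swap, ha]; simp⟩
      · exact hother i j hi hj hi' hj'

/-- Nonzero friezes are tame: the rows satisfy a common three-term recurrence. -/
theorem IsFrieze.three_term {K : Type*} [Field K] {R : Set K} {n : ℕ} {c : ℤ → ℤ → K}
    (h : IsFrieze R n c) (j : ℤ) (t : ℕ) (ht : t ≤ n) :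
    c (j - 1 - t) (j + 1) + c (j - 1 - t) (j - 1) =
      c (j - 1) (j + 1) * c (j - 1 - t) j := by
  obtain ⟨hb, hnz, hdet⟩ := h
  induction t with
  | zero =>
    have h0 := (hb (j - 1)).1
    have h1 := (hb (j - 1)).2.1
    rw [sub_add_cancel] at h1
    simp [h0, h1]
  | succ t ih =>
    have ih := ih (by omega)
    set i : ℤ := j - 1 - ((t + 1 : ℕ) : ℤ) with hi
    push_cast at hi
    have hi1 : j - 1 - (t : ℤ) = i + 1 := by omega
    rw [hi1] at ih
    have ht' : ((t + 1 : ℕ) : ℤ) ≤ n := by exact_mod_cast ht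
    push_cast at ht'
    have d1 := hdet i j (by omega) (by omega)
    have d2 := hdet i (j - 1) (by omega) (by omega)
    rw [sub_add_cancel] at d2
    have hne := (hnz (i + 1) j (by omega) (by omega)).2
    apply mul_left_cancel₀ hne
    linear_combination d2 - d1 + c i j * ih

theorem IsFrieze.exists_int {R : Set ℂ}
    (hR : ∀ z ∈ R, z ≠ 0 → ‖z‖ < 2 → z = 1 ∨ z = -1) {n : ℕ} {c : ℤ → ℤ → ℂ}
    (h : IsFrieze R n c) (i j : ℤ) (hij : i + 1 ≤ j) (hj : j ≤ (n : ℤ) + i + 2) :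
    ∃ a : ℤ, c i j = a := by
  obtain ⟨hb, hnz, hdet⟩ := id h
  have h0 : c i i = 0 := (hb i).1
  have h1 : c i (i + 1) = 1 := (hb i).2.1
  let v : ℕ → ℂ × ℂ := fun k => if k = 0 then (0, -1) else (c i (i + k), c (i + 1) (i + k))
  have hv0 : v 0 = (0, -1) := rfl
  have hv : ∀ k : ℕ, v (k + 1) = (c i (i + k + 1), c (i + 1) (i + k + 1)) := by
    intro k
    simp [v, add_assoc]
  have hvrec : ∀ k : ℕ, k ≤ n → v (k + 2) =
      (c (i + k) (i + k + 2) * (v (k + 1)).1 - (v k).1,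
        c (i + k) (i + k + 2) * (v (k + 1)).2 - (v k).2) := by
    intro k hk
    have r1 := h.three_term (i + k + 1) k hk
    have e1 : i + (k : ℤ) + 1 - 1 - k = i := by ring
    have e2 : i + (k : ℤ) + 1 - 1 = i + k := by ring
    have e3 : i + (k : ℤ) + 1 + 1 = i + k + 2 := by ring
    rw [e1, e2, e3] at r1
    have e4 : v (k + 2) = (c i (i + k + 2), c (i + 1) (i + k + 2)) := by
      rw [hv (k + 1)]; push_cast; congr 2 <;> ring
    cases k with
    | zero =>
      rw [e4, hv, hv0]
      have b1 := (hb (i + 1)).1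
      have b2 := (hb (i + 1)).2.1
      rw [show i + 1 + 1 = i + 2 by ring] at b2
      simp [b1, b2, h1]
    | succ l =>
      have r2 := h.three_term (i + (l + 1 : ℕ) + 1) l (by omega)
      push_cast at r1 r2 e4 ⊢
      rw [show i + ((l : ℤ) + 1) + 1 - 1 - l = i + 1 by ring,
        show i + ((l : ℤ) + 1) + 1 - 1 = i + (l + 1) by ring,
        show i + ((l : ℤ) + 1) + 1 + 1 = i + (l + 1) + 2 by ring] at r2
      rw [e4, hv, hv]
      push_cast
      simp only [Prod.mk.injEq]
      rw [show i + (l : ℤ) + 1 = i + (l + 1) by ring]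
      constructor
      · linear_combination r1
      · linear_combination r2
  have hone : ∀ k : ℕ, k ≤ n + 1 → planeDet (v k) (v (k + 1)) = 1 := by
    intro k
    induction k with
    | zero => intro _; simp [hv 0, hv0, planeDet, h1]
    | succ k ih =>
      intro hk
      rw [← ih (by omega), hvrec k (by omega)]
      simp only [planeDet]
      ring
  have hvc : ∀ k l : ℕ, k + l ≤ n + 1 →
      planeDet (v k) (v (k + l)) = c (i + k) (i + k + l) ∧
      planeDet (v k) (v (k + l + 1)) = c (i + k) (i + k + l + 1) := by
    intro k l
    induction l with
    | zero =>
      intro hk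
      rw [add_zero, hone k hk]
      have b1 := (hb (i + k)).1
      have b2 := (hb (i + k)).2.1
      simp [b1, b2, planeDet]
    | succ l ih =>
      intro hk
      obtain ⟨ih1, ih2⟩ := ih (by omega)
      have r := h.three_term (i + k + l + 1) l (by omega)
      rw [show i + (k : ℤ) + l + 1 - 1 - l = i + k by ring,
        show i + (k : ℤ) + l + 1 - 1 = i + k + l by ring,
        show i + (k : ℤ) + l + 1 + 1 = i + k + l + 2 by ring] at r
      refine ⟨by rw [← add_assoc, ih2]; push_cast; rw [← add_assoc], ?_⟩
      have e : planeDet (v k) (v (k + (l + 1) + 1)) =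
          c (i + k + l) (i + k + l + 2) * planeDet (v k) (v (k + l + 1)) -
            planeDet (v k) (v (k + l)) := by
        have := hvrec (k + l) (by omega)
        push_cast at this
        rw [← add_assoc i] at this
        rw [show k + (l + 1) + 1 = k + l + 2 by ring, this]
        simp only [planeDet]
        ring
      rw [e, ih1, ih2]
      push_cast
      rw [show i + (k : ℤ) + (l + 1) + 1 = i + k + l + 2 by ring]
      linear_combination -r
  have hdiag : ∀ k l : ℕ, k < l → l ≤ n + 2 → planeDet (v k) (v l) = c (i + k) (i + l) := by
    intro k l hkl hl
    obtain ⟨t, rfl⟩ := Nat.exists_eq_add_of_lt hkl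
    rw [(hvc k t (by omega)).2]
    push_cast
    simp only [add_assoc]
  have hint := planeDet_int_of_polygon hR (n + 1) v (fun k hk => Or.inl (hone k hk)) ?_ ?_
  · obtain ⟨l, hl⟩ := Int.eq_ofNat_of_zero_le (show 0 ≤ j - i by omega)
    obtain ⟨a, ha⟩ := hint 0 l (by omega) (by omega)
    rw [hdiag 0 l (by omega) (by omega)] at ha
    refine ⟨a, ?_⟩
    rw [← ha, ← hl]
    simp
  · left
    rw [hdiag 0 (n + 1 + 1) (by omega) le_rfl, ← (hb i).2.2.1]
    push_cast
    congr 1 <;> ring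
  · intro k l hkl hl
    rw [hdiag k l hkl hl]
    exact hnz _ _ (by omega) (by omega)

/-- The quadrilateral with alternating quiddity `a, b`. -/
theorem mem_friezeSubring_of_mul_eq_two {R : Subring ℂ} {a b : ℂ} (ha : a ∈ R) (hb : b ∈ R)
    (hab : a * b = 2) : a ∈ friezeSubring R := by
  have ha0 : a ≠ 0 := by rintro rfl; simp at hab
  have hb0 : b ≠ 0 := by rintro rfl; simp at hab
  apply Subring.subset_closure
  let c : ℤ → ℤ → ℂ := fun i j =>
    if j - i = 1 ∨ j - i = 3 then 1 else if j - i = 2 then (if Even i then a else b) else 0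
  refine ⟨1, c, 0, 2, ⟨?_, ?_, ?_⟩, by norm_num, by norm_num, by simp [c]⟩
  · intro i
    have e1 : ((1 : ℕ) : ℤ) + i + 2 - i = 3 := by push_cast; ring
    have e2 : ((1 : ℕ) : ℤ) + i + 3 - i = 4 := by push_cast; ring
    simp only [c, e1, e2, sub_self, add_sub_cancel_left]
    norm_num
  · intro i j h1 h2
    push_cast at h2
    obtain rfl | rfl | rfl : j = i + 1 ∨ j = i + 2 ∨ j = i + 3 := by omega
    · simp [c, R.one_mem]
    · by_cases hi : Even i <;> simp [c, hi, ha, hb, ha0, hb0]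
    · simp [c, R.one_mem]
  · intro i j h1 h2
    push_cast at h2
    obtain rfl | rfl | rfl : j = i + 1 ∨ j = i + 2 ∨ j = i + 3 := by omega
    · have e1 : i + 1 + 1 - i = 2 := by ring
      simp [c, e1]
    · have e1 : i + 2 + 1 - i = 3 := by ring
      have e2 : i + 2 + 1 - (i + 1) = 2 := by ring
      have e3 : i + 2 - (i + 1) = 1 := by ring
      rcases Int.even_or_odd i with hi | hi
      · simp [c, e1, e2, e3, hi, Int.not_odd_iff_even.mpr hi, hab]; norm_num
      · simp [c, e1, e2, e3, hi, Int.not_even_iff_odd.mpr hi, mul_comm b, hab]; norm_num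
    · have e1 : i + 3 + 1 - i = 4 := by ring
      have e2 : i + 3 + 1 - (i + 1) = 3 := by ring
      have e3 : i + 3 - (i + 1) = 2 := by ring
      simp [c, e1, e2, e3]

/-- The hexagon with alternating quiddity `a, b`. -/
theorem mem_friezeSubring_of_mul_eq_three {R : Subring ℂ} {a b : ℂ} (ha : a ∈ R) (hb : b ∈ R)
    (hab : a * b = 3) : a ∈ friezeSubring R := by
  have ha0 : a ≠ 0 := by rintro rfl; simp at hab
  have hb0 : b ≠ 0 := by rintro rfl; simp at hab
  apply Subring.subset_closure
  let c : ℤ → ℤ → ℂ := fun i j =>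
    if j - i = 1 ∨ j - i = 5 then 1 else if j - i = 2 ∨ j - i = 4 then (if Even i then a else b)
    else if j - i = 3 then 2 else 0
  refine ⟨3, c, 0, 2, ⟨?_, ?_, ?_⟩, by norm_num, by norm_num, by simp [c]⟩
  · intro i
    have e1 : ((3 : ℕ) : ℤ) + i + 2 - i = 5 := by push_cast; ring
    have e2 : ((3 : ℕ) : ℤ) + i + 3 - i = 6 := by push_cast; ring
    simp only [c, e1, e2, sub_self, add_sub_cancel_left]
    norm_num
  · intro i j h1 h2
    push_cast at h2
    obtain rfl | rfl | rfl | rfl | rfl :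
      j = i + 1 ∨ j = i + 2 ∨ j = i + 3 ∨ j = i + 4 ∨ j = i + 5 := by omega
    · simp [c, R.one_mem]
    · by_cases hi : Even i <;> simp [c, hi, ha, hb, ha0, hb0]
    · simp [c]
    · by_cases hi : Even i <;> simp [c, hi, ha, hb, ha0, hb0]
    · simp [c, R.one_mem]
  · intro i j h1 h2
    push_cast at h2
    obtain ⟨k, rfl⟩ : ∃ k, j = i + k := ⟨j - i, by ring⟩
    have e1 : i + k + 1 - i = k + 1 := by ring
    have e2 : i + k + 1 - (i + 1) = k := by ring
    have e3 : i + k - (i + 1) = k - 1 := by ring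
    have hk1 : 1 ≤ k := by omega
    have hk5 : k ≤ 5 := by omega
    rcases Int.even_or_odd i with hi | hi
    · have hi' := Int.not_odd_iff_even.mpr hi
      interval_cases k <;> simp [c, e1, e2, e3, hi, hi', hab] <;> norm_num [mul_comm, hab]
    · have hi' := Int.not_even_iff_odd.mpr hi
      interval_cases k <;> simp [c, e1, e2, e3, hi, hi', hab, mul_comm b] <;> norm_num

theorem friezeSubring_le (R : Subring ℂ) : friezeSubring R ≤ R := by
  rw [friezeSubring, Subring.closure_le]
  rintro x ⟨n, c, i, j, h, h1, h2, rfl⟩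
  exact (h.2.1 i j h1 h2).1

theorem div_two_mem_Od {d : ℤ} (hd : d < 0) (hsf : Squarefree d) {T U : ℤ}
    (h : 4 ∣ T ^ 2 - d * U ^ 2) : (T + U * sqrtNeg d) / 2 ∈ Od d :=
  (mem_Od_iff hd hsf).mpr ⟨T, U, by ring, h⟩

/-- To show that the frieze subring is everything, it suffices to find a generator
of `𝒪_d` as a ring in it. -/
theorem friezeSubring_Od_eq {d : ℤ} (hd : d < 0) (hsf : Squarefree d) {T₀ U₀ : ℤ}
    (hmem : (T₀ + U₀ * sqrtNeg d) / 2 ∈ friezeSubring (Od d))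
    (hgen : ∀ T U : ℤ, 4 ∣ T ^ 2 - d * U ^ 2 → ∃ k m : ℤ, U = k * U₀ ∧ T = 2 * m + k * T₀) :
    friezeSubring (Od d) = Od d := by
  refine le_antisymm (friezeSubring_le _) fun z hz => ?_
  obtain ⟨T, U, hTU, h4⟩ := (mem_Od_iff hd hsf).mp hz
  obtain ⟨k, m, rfl, rfl⟩ := hgen T U h4
  have : z = m + k * ((T₀ + U₀ * sqrtNeg d) / 2) := by
    push_cast at hTU
    linear_combination hTU / 2
  rw [this]
  exact add_mem (intCast_mem _ _) (mul_mem (intCast_mem _ _) hmem)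

theorem int_sq_emod_four (T : ℤ) : T % 2 = 0 ∧ T ^ 2 % 4 = 0 ∨ T % 2 = 1 ∧ T ^ 2 % 4 = 1 := by
  rcases Int.even_or_odd' T with ⟨k, rfl | rfl⟩ <;> ring_nf <;> omega

theorem friezeSubring_Od_eq_of_mem {d : ℤ} (hd : d < 0) (hsf : Squarefree d)
    (hmem : d ∈ ({-1, -2, -3, -7, -11} : Set ℤ)) : friezeSubring (Od d) = Od d := by
  have hs := sqrtNeg_sq hd
  have even_gen : ∀ T U : ℤ, T % 2 = 0 → U % 2 = 0 →
      ∃ k m : ℤ, U = k * 2 ∧ T = 2 * m + k * 0 := fun T U hT hU =>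
    ⟨U / 2, T / 2, by omega, by omega⟩
  have odd_gen : ∀ T U : ℤ, T % 2 = U % 2 →
      ∃ k m : ℤ, U = k * 1 ∧ T = 2 * m + k * 1 := fun T U h =>
    ⟨U, (T - U) / 2, by omega, by omega⟩
  rcases hmem with rfl | rfl | rfl | rfl | rfl
  · refine friezeSubring_Od_eq hd hsf (T₀ := 0) (U₀ := 2) ?_ ?_
    · refine mem_friezeSubring_of_mul_eq_two (div_two_mem_Od hd hsf (by norm_num))
        (div_two_mem_Od hd hsf (T := 0) (U := -4) (by norm_num)) ?_
      push_cast at hs ⊢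
      linear_combination -2 * hs
    · intro T U h
      have := int_sq_emod_four T
      have := int_sq_emod_four U
      apply even_gen <;> omega
  · refine friezeSubring_Od_eq hd hsf (T₀ := 0) (U₀ := 2) ?_ ?_
    · refine mem_friezeSubring_of_mul_eq_two (div_two_mem_Od hd hsf (by norm_num))
        (div_two_mem_Od hd hsf (T := 0) (U := -2) (by norm_num)) ?_
      push_cast at hs ⊢
      linear_combination -hs
    · intro T U h
      have := int_sq_emod_four T
      have := int_sq_emod_four U
      apply even_gen <;> omega
  · refine friezeSubring_Od_eq hd hsf (T₀ := 1) (U₀ := 1) ?_ ?_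
    · refine mem_friezeSubring_of_mul_eq_two (div_two_mem_Od hd hsf (by norm_num))
        (div_two_mem_Od hd hsf (T := 2) (U := -2) (by norm_num)) ?_
      push_cast at hs ⊢
      linear_combination -hs / 2
    · intro T U h
      have := int_sq_emod_four T
      have := int_sq_emod_four U
      apply odd_gen; omega
  · refine friezeSubring_Od_eq hd hsf (T₀ := 1) (U₀ := 1) ?_ ?_
    · refine mem_friezeSubring_of_mul_eq_two (div_two_mem_Od hd hsf (by norm_num))
        (div_two_mem_Od hd hsf (T := 1) (U := -1) (by norm_num)) ?_
      push_cast at hs ⊢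
      linear_combination -hs / 4
    · intro T U h
      have := int_sq_emod_four T
      have := int_sq_emod_four U
      apply odd_gen; omega
  · refine friezeSubring_Od_eq hd hsf (T₀ := 1) (U₀ := 1) ?_ ?_
    · refine mem_friezeSubring_of_mul_eq_three (div_two_mem_Od hd hsf (by norm_num))
        (div_two_mem_Od hd hsf (T := 1) (U := -1) (by norm_num)) ?_
      push_cast at hs ⊢
      linear_combination -hs / 4
    · intro T U h
      have := int_sq_emod_four T
      have := int_sq_emod_four U
      apply odd_gen; omega

theorem friezeSubring_Od_eq_int {d : ℤ} (hd : d < 0) (hsf : Squarefree d)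
    (hmem : d ∉ ({-1, -2, -3, -7, -11} : Set ℤ)) :
    friezeSubring (Od d) = (Int.castRingHom ℂ).range := by
  apply le_antisymm
  · rw [friezeSubring, Subring.closure_le]
    rintro x ⟨n, c, i, j, h, h1, h2, rfl⟩
    have hR : ∀ z ∈ (Od d : Set ℂ), z ≠ 0 → ‖z‖ < 2 → z = 1 ∨ z = -1 := by
      intro z hz hz0 hlt
      rcases int_or_two_le_norm hd hsf hmem hz with ⟨m, rfl⟩ | h
      · rw [Complex.norm_intCast] at hlt
        have hm : |m| < 2 := by exact_mod_cast hlt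
        have hm0 : m ≠ 0 := by exact_mod_cast hz0
        rw [abs_lt] at hm
        obtain rfl | rfl : m = 1 ∨ m = -1 := by omega
        · simp
        · simp
      · linarith
    obtain ⟨a, ha⟩ := h.exists_int hR i j h1 h2
    exact ⟨a, by simp [ha]⟩
  · rintro _ ⟨m, rfl⟩
    exact intCast_mem _ m

theorem stmt19 (d : ℤ) (hd : d < 0) (hsf : Squarefree d) :
    (d ∈ ({-1, -2, -3, -7, -11} : Set ℤ) → friezeSubring (Od d) = Od d) ∧
    (d ∉ ({-1, -2, -3, -7, -11} : Set ℤ) →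
      friezeSubring (Od d) = (Int.castRingHom ℂ).range) :=
  ⟨friezeSubring_Od_eq_of_mem hd hsf, friezeSubring_Od_eq_int hd hsf⟩
end
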